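/- arXiv:1710.03706 — 4 statements merged into one kernel-verified Lean document; each statement's English description precedes it below -/
import Mathlib

section
/- If ĥ ∈ L¹(Δ) satisfies L̂_{P̂} ĥ = ĥ, then the unfolded function F_P(ĥ) satisfies L_P(F_P ĥ) = F_P ĥ; that is, the unfolding of a stationary density of the induced random system is a stationary (not necessarily normalized) density of the original random system. -/
open MeasureTheory Set Filter Topology Classical

/-- Composition of the inverse branches indexed by a list of out-labels along a path:
g_{z₁,ω₁}∘…∘g_{z_n,ω_n} (empty list gives the identity). -/
def comps {Sin Sout Ω : Type*} (g : Sin ⊕ Sout → Ω → ℝ → ℝ) :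
    List Sout → (ℕ → Ω) → ℝ → ℝ
  | [], _ => id
  | s :: l, ωh => g (Sum.inr s) (ωh 0) ∘ comps g l (fun n => ωh (n + 1))

/-- The inverse branch of the first return map associated with a word
z = z₀z₁…z_n (z₀ ∈ S^in, z_i ∈ S^out) and a path ω̂:
g_{z,ω̂} = g_{z₀,ω₀}∘g_{z₁,ω₁}∘…∘g_{z_n,ω_n}. -/
def wComp {Sin Sout Ω : Type*} (g : Sin ⊕ Sout → Ω → ℝ → ℝ)
    (z : Sin × List Sout) (ωh : ℕ → Ω) : ℝ → ℝ :=
  g (Sum.inl z.1) (ωh 0) ∘ comps g z.2 (fun n => ωh (n + 1))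

/-- The one-step annealed transfer operator L_P. -/
noncomputable def LPone {Sin Sout Ω : Type*} [MeasurableSpace Ω]
    (P : Measure Ω) (g : Sin ⊕ Sout → Ω → ℝ → ℝ) (Φ : ℝ → ℝ) (x : ℝ) : ℝ :=
  ∑' s : Sin ⊕ Sout, ∫ ω, Φ (g s ω x) * |derivWithin (g s ω) (Set.Icc 0 1) x| ∂P

/-- The induced (first-return) annealed transfer operator L̂_{P̂}. -/
noncomputable def LPhat {Sin Sout Ω : Type*} [MeasurableSpace Ω]
    (Phat : Measure (ℕ → Ω)) (g : Sin ⊕ Sout → Ω → ℝ → ℝ) (Φ : ℝ → ℝ) (x : ℝ) : ℝ :=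
  ∑' z : Sin × List Sout,
    ∫ ωh, Φ (wComp g z ωh x) * |derivWithin (wComp g z ωh) (Set.Icc 0 1) x| ∂Phat

/-- The unfolding operator F_P(Φ) = 1_Δ Φ + (1 − 1_Δ)·Σ_z ∫ Φ∘g_{z,ω̂}·|g'_{z,ω̂}| dP̂. -/
noncomputable def FPunf {Sin Sout Ω : Type*} [MeasurableSpace Ω] (Δ : Set ℝ)
    (Phat : Measure (ℕ → Ω)) (g : Sin ⊕ Sout → Ω → ℝ → ℝ) (Φ : ℝ → ℝ) (x : ℝ) : ℝ :=
  if x ∈ Δ then Φ x else LPhat Phat g Φ x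

lemma aux_infinitePi {Ω : Type*} [MeasurableSpace Ω] (P : Measure Ω) [IsProbabilityMeasure P]
    (Phat : Measure (ℕ → Ω))
    (hprod : ∀ (n : ℕ) (A : Fin n → Set Ω), (∀ i, MeasurableSet (A i)) →
      Phat {ωh | ∀ i : Fin n, ωh i ∈ A i} = ∏ i, P (A i)) :
    Phat = Measure.infinitePi (fun _ : ℕ => P) := by
  refine Measure.eq_infinitePi _ fun s t ht => ?_
  have h := hprod (s.sup id + 1) (fun i => if (i : ℕ) ∈ s then t i else Set.univ) (by
    intro i
    split_ifs
    · exact ht _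
    · exact MeasurableSet.univ)
  have hlt : ∀ i ∈ s, i < s.sup id + 1 := fun i hi =>
    Nat.lt_succ_of_le (Finset.le_sup (f := id) hi)
  have hset : Set.pi (s : Set ℕ) t = {ωh : ℕ → Ω | ∀ i : Fin (s.sup id + 1),
      ωh i ∈ (if (i : ℕ) ∈ s then t i else Set.univ)} := by
    ext ωh
    simp only [Set.mem_pi, Finset.mem_coe, Set.mem_ofPred_eq]
    constructor
    · intro hh i
      split_ifs with hi
      · exact hh i hi
      · trivial
    · intro hh i hi
      have := hh ⟨i, hlt i hi⟩
      simpa [hi] using this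
  rw [hset, h, Fin.prod_univ_eq_prod_range
    (fun i => P (if i ∈ s then t i else Set.univ)) (s.sup id + 1)]
  have hsub : s ⊆ Finset.range (s.sup id + 1) := fun i hi => Finset.mem_range.2 (hlt i hi)
  rw [← Finset.prod_subset hsub]
  · exact Finset.prod_congr rfl fun i hi => by simp [hi]
  · intro i _ hi
    simp [hi]

lemma aux_update {Ω : Type*} [MeasurableSpace Ω] (P : Measure Ω) [IsProbabilityMeasure P]
    (k : ℕ) :
    MeasurePreserving (fun p : Ω × (ℕ → Ω) => Function.update p.2 k p.1)
      (P.prod (Measure.infinitePi (fun _ : ℕ => P))) (Measure.infinitePi (fun _ : ℕ => P)) := by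
  have hm : Measurable (fun p : Ω × (ℕ → Ω) => Function.update p.2 k p.1) := by
    rw [measurable_pi_iff]
    intro i
    by_cases hi : i = k
    · subst hi
      simpa using measurable_fst
    · simp only [Function.update_of_ne hi]
      exact (measurable_pi_apply i).comp measurable_snd
  refine ⟨hm, Measure.eq_infinitePi _ fun s t ht => ?_⟩
  rw [Measure.map_apply hm (.pi s.countable_toSet fun _ _ => ht _)]
  have hset : (fun p : Ω × (ℕ → Ω) => Function.update p.2 k p.1) ⁻¹' (Set.pi (s : Set ℕ) t)
      = (if k ∈ s then t k else Set.univ) ×ˢ Set.pi ((s.erase k : Finset ℕ) : Set ℕ) t := by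
    ext ⟨a, w⟩
    simp only [Set.mem_preimage, Set.mem_pi, Finset.mem_coe, Set.mem_prod, Finset.mem_erase]
    constructor
    · intro h
      refine ⟨?_, fun i hi => ?_⟩
      · split_ifs with hk
        · simpa using h k hk
        · trivial
      · simpa [Function.update_of_ne hi.1] using h i hi.2
    · rintro ⟨h1, h2⟩ i hi
      by_cases hik : i = k
      · subst hik
        simpa [hi] using h1
      · simpa [Function.update_of_ne hik] using h2 i ⟨hik, hi⟩
  rw [hset, Measure.prod_prod, Measure.infinitePi_pi _ (fun i _ => ht i)]
  by_cases hk : k ∈ s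
  · simp only [hk, if_true]
    exact Finset.mul_prod_erase s (fun i => P (t i)) hk
  · simp [hk, Finset.erase_eq_of_notMem hk]

lemma aux_mono (f : ℝ → ℝ) (c d : ℝ) (hcd : c < d) (hc : ContinuousOn f (Set.Icc 0 1))
    (hm : StrictMonoOn f (Set.Icc (0:ℝ) 1))
    (h0 : volume {x ∈ Set.Icc (0:ℝ) 1 | f x ∈ Set.Icc c d} = 0)
    (x : ℝ) (hx : x ∈ Set.Ioo (0:ℝ) 1) : f x ∉ Set.Icc c d := by
  intro hfx
  have hca : ContinuousAt f x := hc.continuousAt (Icc_mem_nhds hx.1 hx.2)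
  have hxI : x ∈ Set.Icc (0:ℝ) 1 := ⟨hx.1.le, hx.2.le⟩
  have key : ∃ a b : ℝ, a < b ∧ Set.Ioo a b ⊆ {x ∈ Set.Icc (0:ℝ) 1 | f x ∈ Set.Icc c d} := by
    by_cases hd : f x < d
    · have h1 : ∀ᶠ y in 𝓝 x, f y < d ∧ y ∈ Set.Icc (0:ℝ) 1 :=
        (hca.eventually_lt_const hd).and (Icc_mem_nhds hx.1 hx.2)
      obtain ⟨ε, hε, hball⟩ := Metric.eventually_nhds_iff.1 h1
      refine ⟨x, x + ε, by linarith, fun y hy => ?_⟩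
      have := hball (y := y) (by rw [Real.dist_eq, abs_lt]; constructor <;> linarith [hy.1, hy.2])
      exact ⟨this.2, hfx.1.trans (hm hxI this.2 hy.1).le, this.1.le⟩
    · have hd' : c < f x := by linarith
      have h1 : ∀ᶠ y in 𝓝 x, c < f y ∧ y ∈ Set.Icc (0:ℝ) 1 :=
        (hca.eventually_const_lt hd').and (Icc_mem_nhds hx.1 hx.2)
      obtain ⟨ε, hε, hball⟩ := Metric.eventually_nhds_iff.1 h1
      refine ⟨x - ε, x, by linarith, fun y hy => ?_⟩
      have := hball (y := y) (by rw [Real.dist_eq, abs_lt]; constructor <;> linarith [hy.1, hy.2])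
      exact ⟨this.2, this.1.le, (hm this.2 hxI hy.2).le.trans hfx.2⟩
  obtain ⟨a, b, hab, hsub⟩ := key
  have := measure_mono_null hsub h0
  rw [Real.volume_Ioo, ENNReal.ofReal_eq_zero] at this
  linarith

lemma aux_anti (f : ℝ → ℝ) (c d : ℝ) (hcd : c < d) (hc : ContinuousOn f (Set.Icc 0 1))
    (hm : StrictAntiOn f (Set.Icc (0:ℝ) 1))
    (h0 : volume {x ∈ Set.Icc (0:ℝ) 1 | f x ∈ Set.Icc c d} = 0)
    (x : ℝ) (hx : x ∈ Set.Ioo (0:ℝ) 1) : f x ∉ Set.Icc c d := by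
  intro hfx
  refine aux_mono (fun y => - f y) (-d) (-c) (by linarith) hc.neg
    (fun a ha b hb hab => neg_lt_neg (hm ha hb hab)) ?_ x hx ⟨by linarith [hfx.2], by linarith [hfx.1]⟩
  convert h0 using 3
  ext y
  simp only [Set.mem_Icc, neg_le_neg_iff]
  tauto

section words
variable {Sin Sout Ω : Type*} (g : Sin ⊕ Sout → Ω → ℝ → ℝ)

lemma comps_append (l : List Sout) (s : Sout) (w : ℕ → Ω) :
    comps g (l ++ [s]) w = comps g l w ∘ g (Sum.inr s) (w l.length) := by
  induction l generalizing w with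
  | nil => rfl
  | cons a l ih => simp only [List.cons_append, comps, ih, List.length_cons]; rfl

lemma comps_congr (l : List Sout) (w w' : ℕ → Ω) (h : ∀ i < l.length, w i = w' i) :
    comps g l w = comps g l w' := by
  induction l generalizing w w' with
  | nil => rfl
  | cons a l ih =>
    simp only [comps]
    rw [h 0 (by simp), ih (fun n => w (n + 1)) (fun n => w' (n + 1))
      (fun i hi => h (i + 1) (by simpa using hi))]

lemma wComp_append (a : Sin) (l : List Sout) (s : Sout) (w : ℕ → Ω) (o : Ω) :
    wComp g (a, l ++ [s]) (Function.update w (l.length + 1) o)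
      = wComp g (a, l) w ∘ g (Sum.inr s) o := by
  simp only [wComp, comps_append]
  rw [comps_congr g l _ (fun n => w (n + 1)) (fun i hi => by
    rw [Function.update_of_ne]; omega)]
  rw [Function.update_self, Function.update_of_ne (by omega)]
  rfl

lemma comps_maps (hmaps : ∀ s ω, MapsTo (g s ω) (Set.Icc (0:ℝ) 1) (Set.Icc 0 1))
    (l : List Sout) (w : ℕ → Ω) : MapsTo (comps g l w) (Set.Icc (0:ℝ) 1) (Set.Icc 0 1) := by
  induction l generalizing w with
  | nil => exact mapsTo_id _
  | cons a l ih => exact (hmaps _ _).comp (ih _)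

lemma comps_diff (hmaps : ∀ s ω, MapsTo (g s ω) (Set.Icc (0:ℝ) 1) (Set.Icc 0 1))
    (hdiff : ∀ s ω, DifferentiableOn ℝ (g s ω) (Set.Icc 0 1))
    (l : List Sout) (w : ℕ → Ω) : DifferentiableOn ℝ (comps g l w) (Set.Icc (0:ℝ) 1) := by
  induction l generalizing w with
  | nil => exact differentiableOn_id
  | cons a l ih => exact (hdiff _ _).comp (ih _) (comps_maps g hmaps _ _)

lemma wComp_diff (hmaps : ∀ s ω, MapsTo (g s ω) (Set.Icc (0:ℝ) 1) (Set.Icc 0 1))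
    (hdiff : ∀ s ω, DifferentiableOn ℝ (g s ω) (Set.Icc 0 1))
    (z : Sin × List Sout) (w : ℕ → Ω) : DifferentiableOn ℝ (wComp g z w) (Set.Icc (0:ℝ) 1) :=
  (hdiff _ _).comp (comps_diff g hmaps hdiff _ _) (comps_maps g hmaps _ _)

lemma wordBij : Function.Bijective (Sum.elim (fun a => (a, []))
    (fun p => (p.2.1, p.2.2 ++ [p.1])) :
      Sin ⊕ (Sout × (Sin × List Sout)) → Sin × List Sout) := by
  constructor
  · rintro (a | ⟨s, a, l⟩) (b | ⟨t, b, m⟩) h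
    · simpa using h
    · simp at h
    · simp at h
    · simp at h
      obtain ⟨h1, h2, h3⟩ := h
      simp [h1, h2, h3]
  · rintro ⟨a, l⟩
    rcases List.eq_nil_or_concat l with rfl | ⟨m, s, rfl⟩
    · exact ⟨Sum.inl a, rfl⟩
    · exact ⟨Sum.inr (s, a, m), by simp⟩

end words

/-- if hh ∈ L¹(Δ) satisfies L̂_{P̂}hh = hh, then the unfolded function F_P(hh)
satisfies L_P(F_P hh) = F_P hh, i.e. the unfolding of a stationary density of the induced
random system is a stationary (not necessarily normalized) density of the original one. -/
theorem stmt4 {Sin Sout Ω : Type*} [Countable Sin] [Countable Sout] [MeasurableSpace Ω]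
    (c d : ℝ) (hcd : c < d) (Δ : Set ℝ) (hΔ : Δ = Set.Icc c d)
    (hΔX : Δ ⊆ Set.Icc 0 1)
    (P : Measure Ω) (hPp : IsProbabilityMeasure P)
    (Phat : Measure (ℕ → Ω)) (hPhp : IsProbabilityMeasure Phat)
    -- P̂ = P^ℕ : the finite-dimensional marginals of P̂ are products of copies of P
    (hprod : ∀ (n : ℕ) (A : Fin n → Set Ω), (∀ i, MeasurableSet (A i)) →
      Phat {ωh | ∀ i : Fin n, ωh i ∈ A i} = ∏ i, P (A i))
    (g : Sin ⊕ Sout → Ω → ℝ → ℝ)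
    (hdiff : ∀ s ω, DifferentiableOn ℝ (g s ω) (Set.Icc 0 1))
    (hmaps : ∀ s ω, MapsTo (g s ω) (Set.Icc (0:ℝ) 1) (Set.Icc 0 1))
    (hmono : ∀ s ω, StrictMonoOn (g s ω) (Set.Icc (0:ℝ) 1) ∨
      StrictAntiOn (g s ω) (Set.Icc (0:ℝ) 1))
    (hmeas : ∀ s x, Measurable (fun ω => g s ω x))
    -- in-branches have domains inside Δ, out-branches outside Δ (mod 0)
    (hin : ∀ s : Sin, ∀ ω, MapsTo (g (Sum.inl s) ω) (Set.Icc (0:ℝ) 1) Δ)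
    (hout : ∀ s : Sout, ∀ ω, volume {x ∈ Set.Icc (0:ℝ) 1 | g (Sum.inr s) ω x ∈ Δ} = 0)
    (hh : ℝ → ℝ) (hint : IntegrableOn hh Δ)
    -- absolute convergence of all the series involved, in L¹
    (habs1 : ∀ x ∈ Set.Icc (0:ℝ) 1, Summable fun z : Sin × List Sout =>
      ∫ ωh, |hh (wComp g z ωh x)| * |derivWithin (wComp g z ωh) (Set.Icc 0 1) x| ∂Phat)
    (habs2 : ∀ x ∈ Set.Icc (0:ℝ) 1, ∀ z : Sin × List Sout, Integrable
      (fun ωh => hh (wComp g z ωh x) * |derivWithin (wComp g z ωh) (Set.Icc 0 1) x|) Phat)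
    (habs3 : ∀ x ∈ Set.Icc (0:ℝ) 1, Summable fun s : Sin ⊕ Sout =>
      ∫ ω, |FPunf Δ Phat g hh (g s ω x)| * |derivWithin (g s ω) (Set.Icc 0 1) x| ∂P)
    (habs4 : ∀ x ∈ Set.Icc (0:ℝ) 1, ∀ s : Sin ⊕ Sout, Integrable
      (fun ω => FPunf Δ Phat g hh (g s ω x) * |derivWithin (g s ω) (Set.Icc 0 1) x|) P)
    -- hh is a fixed point of the induced transfer operator
    (hfix : ∀ᵐ x ∂(volume.restrict Δ), LPhat Phat g hh x = hh x) :
    ∀ᵐ x ∂(volume.restrict (Set.Icc (0:ℝ) 1)),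
      LPone P g (FPunf Δ Phat g hh) x = FPunf Δ Phat g hh x := by
  have hPhat := aux_infinitePi P Phat hprod
  have hupd : ∀ k, MeasurePreserving (fun p : Ω × (ℕ → Ω) => Function.update p.2 k p.1)
      (P.prod Phat) Phat := by
    rw [hPhat]; exact aux_update P
  have heval : MeasurePreserving (Function.eval 0) Phat P := by
    rw [hPhat]; exact measurePreserving_eval_infinitePi (fun _ : ℕ => P) 0
  have hnot : ∀ x ∈ Set.Ioo (0:ℝ) 1, ∀ s ω, g (Sum.inr s) ω x ∉ Δ := by
    intro x hx s ω
    have h0 := hout s ω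
    rw [hΔ] at h0 ⊢
    rcases hmono (Sum.inr s) ω with hm | hm
    · exact aux_mono _ c d hcd (hdiff _ _).continuousOn hm h0 x hx
    · exact aux_anti _ c d hcd (hdiff _ _).continuousOn hm h0 x hx
  have main : ∀ x ∈ Set.Ioo (0:ℝ) 1, LPone P g (FPunf Δ Phat g hh) x = LPhat Phat g hh x := by
    intro x hxo
    have hx : x ∈ Set.Icc (0:ℝ) 1 := ⟨hxo.1.le, hxo.2.le⟩
    -- the terms
    set G : Sin × List Sout → (ℕ → Ω) → ℝ := fun z ωh =>
      hh (wComp g z ωh x) * |derivWithin (wComp g z ωh) (Set.Icc 0 1) x| with hG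
    have hGint : ∀ z, Integrable (G z) Phat := habs2 x hx
    have hGnorm : ∀ z, (∫ ωh, ‖G z ωh‖ ∂Phat) =
        ∫ ωh, |hh (wComp g z ωh x)| * |derivWithin (wComp g z ωh) (Set.Icc 0 1) x| ∂Phat := by
      intro z; simp only [hG, Real.norm_eq_abs, abs_mul, abs_abs]
    have hSn : Summable fun z => ∫ ωh, ‖G z ωh‖ ∂Phat := by
      simp only [hGnorm]; exact habs1 x hx
    have hS : Summable fun z => ∫ ωh, G z ωh ∂Phat :=
      Summable.of_norm_bounded hSn fun z => norm_integral_le_integral_norm _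
    let e := Equiv.ofBijective _ (wordBij (Sin := Sin) (Sout := Sout))
    have hSe : Summable ((fun z => ∫ ωh, G z ωh ∂Phat) ∘ e) := e.summable_iff.2 hS
    have hSne : Summable ((fun z => ∫ ωh, ‖G z ωh‖ ∂Phat) ∘ e) := e.summable_iff.2 hSn
    -- in terms
    have hinl : ∀ a : Sin, (∫ ω, FPunf Δ Phat g hh (g (Sum.inl a) ω x) *
        |derivWithin (g (Sum.inl a) ω) (Set.Icc 0 1) x| ∂P) = ∫ ωh, G (a, []) ωh ∂Phat := by
      intro a
      have hi := habs4 x hx (Sum.inl a)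
      rw [← heval.map_eq] at hi
      have := integral_map heval.measurable.aemeasurable hi.aestronglyMeasurable
      rw [heval.map_eq] at this
      rw [this]
      refine integral_congr_ae (Eventually.of_forall fun ωh => ?_)
      simp only [FPunf, if_pos (hin a _ hx), hG]
      rfl
    -- the function G on the product
    have hGR : ∀ (s : Sout) (a : Sin) (l : List Sout) (ω : Ω) (ωh : ℕ → Ω),
        G (a, l ++ [s]) (Function.update ωh (l.length + 1) ω) =
        hh (wComp g (a, l) ωh (g (Sum.inr s) ω x)) *
          |derivWithin (wComp g (a, l) ωh) (Set.Icc 0 1) (g (Sum.inr s) ω x)| *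
          |derivWithin (g (Sum.inr s) ω) (Set.Icc 0 1) x| := by
      intro s a l ω ωh
      simp only [hG, wComp_append]
      rw [derivWithin_comp x (wComp_diff g hmaps hdiff _ _ _ (hmaps _ _ hx)) (hdiff _ _ x hx)
        (hmaps _ _), abs_mul, Function.comp_apply, mul_assoc]
    have hinr : ∀ s : Sout, (∫ ω, FPunf Δ Phat g hh (g (Sum.inr s) ω x) *
        |derivWithin (g (Sum.inr s) ω) (Set.Icc 0 1) x| ∂P) =
          ∑' z : Sin × List Sout, ∫ ωh, G (z.1, z.2 ++ [s]) ωh ∂Phat := by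
      intro s
      let H : Sin × List Sout → Ω × (ℕ → Ω) → ℝ := fun z p =>
        G (z.1, z.2 ++ [s]) (Function.update p.2 (z.2.length + 1) p.1)
      have hHint : ∀ z, Integrable (H z) (P.prod Phat) := fun z =>
        (hupd (z.2.length + 1)).integrable_comp_of_integrable (hGint (z.1, z.2 ++ [s]))
      have hHeq : ∀ z, (∫ ω, ∫ ωh, H z (ω, ωh) ∂Phat ∂P) =
          ∫ ωh, G (z.1, z.2 ++ [s]) ωh ∂Phat := by
        intro z
        rw [← integral_prod _ (hHint z)]
        have hm := hupd (z.2.length + 1)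
        have hi := hGint (z.1, z.2 ++ [s])
        rw [← hm.map_eq] at hi
        have := integral_map hm.measurable.aemeasurable hi.aestronglyMeasurable
        rw [hm.map_eq] at this
        exact this.symm
      have hHeqn : ∀ z, (∫ ω, ∫ ωh, ‖H z (ω, ωh)‖ ∂Phat ∂P) =
          ∫ ωh, ‖G (z.1, z.2 ++ [s]) ωh‖ ∂Phat := by
        intro z
        rw [← integral_prod _ (hHint z).norm]
        have hm := hupd (z.2.length + 1)
        have hi := (hGint (z.1, z.2 ++ [s])).norm
        rw [← hm.map_eq] at hi
        have := integral_map hm.measurable.aemeasurable hi.aestronglyMeasurable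
        rw [hm.map_eq] at this
        exact this.symm
      have hsumn : Summable fun z : Sin × List Sout =>
          ∫ ωh, ‖G (z.1, z.2 ++ [s]) ωh‖ ∂Phat := by
        have := hSne.comp_injective (i := fun z : Sin × List Sout => Sum.inr (s, z))
          (fun z z' h => by simpa using h)
        exact this
      have hsw := hasSum_integral_of_summable_integral_norm (μ := P)
        (F := fun (z : Sin × List Sout) ω => ∫ ωh, H z (ω, ωh) ∂Phat)
        (fun z => (hHint z).integral_prod_left) (by
          refine Summable.of_nonneg_of_le (fun z => integral_nonneg fun _ => norm_nonneg _)
            (fun z => ?_) hsumn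
          rw [← hHeqn z]
          exact integral_mono (hHint z).integral_prod_left.norm
            (hHint z).norm.integral_prod_left
            (fun ω => norm_integral_le_integral_norm _))
      simp only [hHeq] at hsw
      rw [hsw.tsum_eq]
      refine integral_congr_ae (Eventually.of_forall fun ω => ?_)
      simp only [FPunf, if_neg (hnot x hxo s ω), LPhat]
      rw [← tsum_mul_right]
      refine tsum_congr fun z => ?_
      rw [← integral_mul_const]
      refine integral_congr_ae (Eventually.of_forall fun ωh => ?_)
      exact (hGR s z.1 z.2 ω ωh).symm
    have hSone : Summable fun s : Sin ⊕ Sout => ∫ ω, FPunf Δ Phat g hh (g s ω x) *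
        |derivWithin (g s ω) (Set.Icc 0 1) x| ∂P := by
      refine Summable.of_norm_bounded (habs3 x hx) fun s => ?_
      refine (norm_integral_le_integral_norm _).trans (le_of_eq ?_)
      simp only [Real.norm_eq_abs, abs_mul, abs_abs]
    have hL : LPhat Phat g hh x = ∑' z, ∫ ωh, G z ωh ∂Phat := rfl
    rw [hL, ← e.tsum_eq]
    have hSinr : Summable ((fun z => ∫ ωh, G (e z) ωh ∂Phat) ∘ Sum.inr) :=
      hSe.comp_injective Sum.inr_injective
    have hSinl : Summable ((fun z => ∫ ωh, G (e z) ωh ∂Phat) ∘ Sum.inl) :=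
      hSe.comp_injective Sum.inl_injective
    rw [Summable.tsum_sum hSinl hSinr]
    unfold LPone
    rw [Summable.tsum_sum (hSone.comp_injective Sum.inl_injective)
      (hSone.comp_injective Sum.inr_injective)]
    congr 1
    · exact tsum_congr hinl
    · rw [tsum_congr hinr]
      exact (hSinr.tsum_prod).symm
  have hfix' : ∀ᵐ x ∂(volume : Measure ℝ), x ∈ Δ → LPhat Phat g hh x = hh x := by
    rw [← ae_restrict_iff' (by rw [hΔ]; exact measurableSet_Icc)]
    exact hfix
  rw [← Measure.restrict_congr_set (Ioo_ae_eq_Icc (μ := (volume : Measure ℝ)))]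
  rw [ae_restrict_iff' measurableSet_Ioo]
  filter_upwards [hfix'] with x hfx hx
  rw [main x hx]
  unfold FPunf
  split_ifs with hxΔ
  · exact hfx hxΔ
  · rfl
end

section
/- Suppose: (1) ε ↦ L_ε h₀ ∈ B is differentiable at ε = 0; (2) for every φ ∈ B, ε ↦ L_ε φ ∈ B is continuous at ε = 0; (3) the operators L_ε have a uniform spectral gap on B: there exist θ ∈ (0,1) and C > 0, independent of ε, such that for every φ ∈ B₀ and every n ≥ 1, ‖L_ε^n φ‖_B ≤ C θ^n ‖φ‖_B. Then ε ↦ h_ε is differentiable at ε = 0 as an element of B, and the linear response formula holds: ∂_ε h_ε|_{ε=0} = (I − L₀)^{-1} (∂_ε L_ε h₀|_{ε=0}), where ∂_ε L_ε h₀|_{ε=0} ∈ B₀ and (I − L₀)^{-1} denotes the (well-defined, bounded) inverse of I − L₀ on B₀. -/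
open MeasureTheory

theorem gap_bound_aux {B : Type*} [NormedAddCommGroup B] [NormedSpace ℝ B]
    (J : B →L[ℝ] ℝ) (T : B →L[ℝ] B) (hJ : ∀ φ, J (T φ) = J φ) (C θ : ℝ) (hC : 0 < C)
    (h0 : 0 < θ) (h1 : θ < 1)
    (hg : ∀ φ, J φ = 0 → ∀ n : ℕ, 1 ≤ n → ‖(T ^ n) φ‖ ≤ C * θ ^ n * ‖φ‖) :
    (∀ ψ, J ψ = 0 → ∀ n : ℕ, ‖(T ^ n) ψ‖ ≤ (1 + C) * ‖ψ‖ * θ ^ n) ∧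
    ∀ φ, J φ = 0 → ‖φ‖ ≤ (1 + C) * (1 - θ)⁻¹ * ‖φ - T φ‖ := by
  have hb : ∀ ψ, J ψ = 0 → ∀ n : ℕ, ‖(T ^ n) ψ‖ ≤ (1 + C) * ‖ψ‖ * θ ^ n := by
    intro ψ hψ n
    rcases Nat.eq_zero_or_pos n with rfl | hn
    · simp
      nlinarith [norm_nonneg ψ, mul_nonneg hC.le (norm_nonneg ψ)]
    · have := hg ψ hψ n hn
      have h2 : 0 ≤ ‖ψ‖ * θ ^ n := by positivity
      nlinarith
  refine ⟨hb, fun φ hφ => ?_⟩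
  have hψ : J (φ - T φ) = 0 := by simp [hJ]
  have hs : ∀ N : ℕ, ∑ n ∈ Finset.range N, (T ^ n) (φ - T φ) = φ - (T ^ N) φ := by
    intro N
    induction N with
    | zero => simp
    | succ k ih =>
      rw [Finset.sum_range_succ, ih, pow_succ, map_sub]
      simp [ContinuousLinearMap.mul_apply]
  have hgeo := hasSum_geometric_of_lt_one h0.le h1
  have hle : ∀ N : ℕ, ‖φ - (T ^ N) φ‖ ≤ (1 + C) * (1 - θ)⁻¹ * ‖φ - T φ‖ := by
    intro N
    rw [← hs N]
    calc _ ≤ ∑ n ∈ Finset.range N, ‖(T ^ n) (φ - T φ)‖ := norm_sum_le _ _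
      _ ≤ ∑ n ∈ Finset.range N, (1 + C) * ‖φ - T φ‖ * θ ^ n :=
          Finset.sum_le_sum fun n _ => hb _ hψ n
      _ = (1 + C) * ‖φ - T φ‖ * ∑ n ∈ Finset.range N, θ ^ n := by rw [Finset.mul_sum]
      _ ≤ (1 + C) * ‖φ - T φ‖ * (1 - θ)⁻¹ := by
          gcongr
          exact sum_le_hasSum _ (fun i _ => by positivity) hgeo
      _ = _ := by ring
  have ht : Filter.Tendsto (fun N : ℕ => (T ^ N) φ) Filter.atTop (nhds 0) := by
    apply squeeze_zero_norm (hb φ hφ)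
    simpa using (tendsto_pow_atTop_nhds_zero_of_lt_one h0.le h1).const_mul ((1 + C) * ‖φ‖)
  have ht2 := (ht.const_sub φ).norm
  rw [sub_zero] at ht2
  exact le_of_tendsto' ht2 hle

theorem gap_inv_aux {B : Type*} [NormedAddCommGroup B] [NormedSpace ℝ B] [CompleteSpace B]
    (J : B →L[ℝ] ℝ) (T : B →L[ℝ] B) (hJ : ∀ φ, J (T φ) = J φ) (D θ : ℝ)
    (h0 : 0 < θ) (h1 : θ < 1) (ψ : B) (hψ : J ψ = 0)
    (hb : ∀ n : ℕ, ‖(T ^ n) ψ‖ ≤ D * θ ^ n) : ∃ φ, J φ = 0 ∧ φ - T φ = ψ := by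
  have hs : Summable (fun n : ℕ => (T ^ n) ψ) :=
    Summable.of_norm_bounded ((summable_geometric_of_lt_one h0.le h1).mul_left D) hb
  have hJn : ∀ n : ℕ, J ((T ^ n) ψ) = 0 := by
    intro n
    induction n with
    | zero => simpa using hψ
    | succ k ih => rw [pow_succ', ContinuousLinearMap.mul_apply, hJ, ih]
  refine ⟨∑' n : ℕ, (T ^ n) ψ, ?_, ?_⟩
  · rw [J.map_tsum hs]; simp only [hJn, tsum_zero]
  · rw [T.map_tsum hs, hs.tsum_eq_zero_add]
    simp [pow_succ', ContinuousLinearMap.mul_apply]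

theorem response_aux {B : Type*} [NormedAddCommGroup B] [NormedSpace ℝ B] [CompleteSpace B]
    (J : B →L[ℝ] ℝ) (V : Set ℝ) (hV : V ∈ nhds (0:ℝ)) (L : ℝ → B →L[ℝ] B)
    (hmean : ∀ ε ∈ V, ∀ φ : B, J (L ε φ) = J φ)
    (h : ℝ → B) (hfix : ∀ ε ∈ V, L ε (h ε) = h ε) (hnorm : ∀ ε ∈ V, J (h ε) = 1)
    (hd : ∃ q : B, HasDerivAt (fun ε => L ε (h 0)) q 0)
    (hcont : ∀ φ : B, Filter.Tendsto (fun ε => L ε φ) (nhds 0) (nhds (L 0 φ)))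
    (hgap : ∃ C > (0:ℝ), ∃ θ ∈ Set.Ioo (0:ℝ) 1, ∀ ε ∈ V, ∀ φ : B,
      J φ = 0 → ∀ n : ℕ, 1 ≤ n → ‖(L ε ^ n) φ‖ ≤ C * θ ^ n * ‖φ‖) :
    ∃ q hstar : B,
      HasDerivAt (fun ε => L ε (h 0)) q 0 ∧
      J q = 0 ∧
      (∃ C > (0:ℝ), ∀ ψ : B, J ψ = 0 →
        ∃ φ : B, (J φ = 0 ∧ φ - L 0 φ = ψ ∧ ‖φ‖ ≤ C * ‖ψ‖) ∧
          ∀ φ' : B, J φ' = 0 → φ' - L 0 φ' = ψ → φ' = φ) ∧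
      J hstar = 0 ∧
      hstar - L 0 hstar = q ∧
      HasDerivAt h hstar 0 := by
  obtain ⟨q, hq⟩ := hd
  obtain ⟨C, hC, θ, ⟨h0, h1⟩, hg⟩ := hgap
  have hV0 : (0:ℝ) ∈ V := mem_of_mem_nhds hV
  have key := fun ε (hε : ε ∈ V) => gap_bound_aux J (L ε) (hmean ε hε) C θ hC h0 h1 (hg ε hε)
  have hinv := fun ψ (hψ : J ψ = 0) =>
    gap_inv_aux J (L 0) (hmean 0 hV0) _ θ h0 h1 ψ hψ ((key 0 hV0).1 ψ hψ)
  have hJq : J q = 0 := by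
    have e1 : HasDerivAt (fun ε => J (L ε (h 0))) (J q) 0 := J.hasFDerivAt.comp_hasDerivAt 0 hq
    have e2 : HasDerivAt (fun ε => J (L ε (h 0))) 0 0 := by
      apply (hasDerivAt_const (0:ℝ) (1:ℝ)).congr_of_eventuallyEq
      filter_upwards [hV] with ε hε
      rw [hmean ε hε, hnorm 0 hV0]
    exact e1.unique e2
  obtain ⟨s, hs1, hs2⟩ := hinv q hJq
  have hK : 0 < (1 + C) * (1 - θ)⁻¹ := by
    have : 0 < 1 - θ := by linarith
    positivity
  refine ⟨q, s, hq, hJq, ⟨_, hK, fun ψ hψ => ?_⟩, hs1, hs2, ?_⟩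
  · obtain ⟨φ, a, b⟩ := hinv ψ hψ
    refine ⟨φ, ⟨a, b, ?_⟩, fun φ' a' b' => ?_⟩
    · have := (key 0 hV0).2 φ a
      rwa [b] at this
    · have := (key 0 hV0).2 (φ' - φ) (by simp [a, a'])
      have e : φ' - φ - L 0 (φ' - φ) = 0 := by
        rw [map_sub]
        calc _ = (φ' - L 0 φ') - (φ - L 0 φ) := by abel
          _ = 0 := by rw [b, b', sub_self]
      rw [e, norm_zero, mul_zero] at this
      exact sub_eq_zero.1 (norm_le_zero_iff.1 this)
  · rw [hasDerivAt_iff_isLittleO] at hq ⊢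
    have o2 : (fun ε : ℝ => (ε - 0) • (L ε s - L 0 s)) =o[nhds 0] fun ε : ℝ => ε - 0 := by
      have : (fun ε : ℝ => L ε s - L 0 s) =o[nhds 0] fun _ : ℝ => (1:ℝ) := by
        rw [Asymptotics.isLittleO_one_iff]
        simpa using (hcont s).sub_const (L 0 s)
      simpa using (Asymptotics.isBigO_refl (fun ε : ℝ => ε - 0) (nhds 0)).smul_isLittleO this
    refine Asymptotics.IsBigO.trans_isLittleO ?_ (hq.add o2)
    apply Asymptotics.IsBigO.of_bound ((1 + C) * (1 - θ)⁻¹)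
    filter_upwards [hV] with ε hε
    have := (key ε hε).2 (h ε - h 0 - (ε - 0) • s)
      (by simp [hnorm ε hε, hnorm 0 hV0, hs1])
    refine this.trans_eq ?_
    congr 2
    rw [← hs2, map_sub, map_sub, hfix ε hε, hfix 0 hV0, map_smul, smul_sub, smul_sub]
    abel

/-- abstract linear response for a family of Markov operators with a uniform
spectral gap.  B is a Banach space continuously embedded (by ι) in L¹(X,m), containing the
constants; L_ε are Markov operators with normalized fixed points h_ε.  If ε ↦ L_ε h₀ is
differentiable at 0, ε ↦ L_ε φ is continuous at 0 for each φ, and the L_ε have a uniform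
spectral gap on the zero-mean part B₀, then ε ↦ h_ε is differentiable at 0 and
∂_ε h_ε|₀ = (I−L₀)^{-1} ∂_ε L_ε h₀|₀, with (I−L₀)^{-1} well-defined and bounded on B₀. -/
theorem stmt8
    {X : Type*} [MeasurableSpace X] (m : Measure X) [IsProbabilityMeasure m]
    {B : Type*} [NormedAddCommGroup B] [NormedSpace ℝ B] [CompleteSpace B]
    (ι : B →L[ℝ] Lp ℝ 1 m) (hι : Function.Injective ι)
    (hconst : ∃ c : B, (ι c : X → ℝ) =ᵐ[m] fun _ => (1:ℝ))
    (V : Set ℝ) (hV : V ∈ nhds (0:ℝ))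
    (L : ℝ → B →L[ℝ] B)
    (hpos : ∀ ε ∈ V, ∀ φ : B, ((0 : X → ℝ) ≤ᵐ[m] (ι φ : X → ℝ)) →
      (0 : X → ℝ) ≤ᵐ[m] (ι (L ε φ) : X → ℝ))
    (hmean : ∀ ε ∈ V, ∀ φ : B,
      ∫ x, (ι (L ε φ) : X → ℝ) x ∂m = ∫ x, (ι φ : X → ℝ) x ∂m)
    (h : ℝ → B)
    (hfix : ∀ ε ∈ V, L ε (h ε) = h ε)
    (hnorm : ∀ ε ∈ V, ∫ x, (ι (h ε) : X → ℝ) x ∂m = 1)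
    (hd : ∃ q : B, HasDerivAt (fun ε => L ε (h 0)) q 0)
    (hcont : ∀ φ : B, Filter.Tendsto (fun ε => L ε φ) (nhds 0) (nhds (L 0 φ)))
    (hgap : ∃ C > (0:ℝ), ∃ θ ∈ Set.Ioo (0:ℝ) 1, ∀ ε ∈ V, ∀ φ : B,
      (∫ x, (ι φ : X → ℝ) x ∂m) = 0 → ∀ n : ℕ, 1 ≤ n →
        ‖(L ε ^ n) φ‖ ≤ C * θ ^ n * ‖φ‖) :
    ∃ q hstar : B,
      HasDerivAt (fun ε => L ε (h 0)) q 0 ∧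
      (∫ x, (ι q : X → ℝ) x ∂m) = 0 ∧
      (∃ C > (0:ℝ), ∀ ψ : B, (∫ x, (ι ψ : X → ℝ) x ∂m) = 0 →
        ∃ φ : B, ((∫ x, (ι φ : X → ℝ) x ∂m) = 0 ∧ φ - L 0 φ = ψ ∧ ‖φ‖ ≤ C * ‖ψ‖) ∧
          ∀ φ' : B, (∫ x, (ι φ' : X → ℝ) x ∂m) = 0 → φ' - L 0 φ' = ψ → φ' = φ) ∧
      (∫ x, (ι hstar : X → ℝ) x ∂m) = 0 ∧
      hstar - L 0 hstar = q ∧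
      HasDerivAt h hstar 0 := by
  let J : B →L[ℝ] ℝ := (L1.integralCLM (α := X) (E := ℝ) (μ := m)).comp ι
  have hJ : ∀ φ : B, ∫ x, (ι φ : X → ℝ) x ∂m = J φ := by
    intro φ
    rw [← L1.integral_eq_integral, L1.integral_eq]
    rfl
  simp only [hJ] at hmean hnorm hgap ⊢
  exact response_aux J V hV L hmean h hfix hnorm hd hcont hgap
end

section
/- Under assumptions (A1) and (A2) there exist constants κ ∈ (0,1), D₁ > 0 and n₁ ∈ ℕ, independent of ε ∈ V and of the random path, such that for every n ≥ n₁, every (ω₀, …, ω_{n−1}) ∈ Ω^n and every Lipschitz function Φ on X, the n-step transfer operator L_ω^n = L_{T_{ω_{n−1}}}∘…∘L_{T_{ω₀}} satisfies ‖L_ω^n Φ‖_{Lip} ≤ κ^n ‖Φ‖_{Lip} + D₁ ‖Φ‖_∞. Consequently the same inequality holds for L_{P_ε}^n for every ε ∈ V, and each L_{P_ε} admits a spectral gap on the space of Lipschitz functions; in particular for each ε ∈ V the random system has a unique stationary density h_ε, which is Lipschitz and strictly positive on X. -/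
open MeasureTheory Set Filter Topology

/-- Sup norm over the interval [a,b]. -/
noncomputable def supOn (a b : ℝ) (f : ℝ → ℝ) : ℝ := ⨆ x : Set.Icc a b, |f x|

/-- Best Lipschitz constant of f on [a,b]. -/
noncomputable def lipC (a b : ℝ) (f : ℝ → ℝ) : ℝ :=
  sInf {c : ℝ | 0 ≤ c ∧ ∀ x ∈ Set.Icc a b, ∀ y ∈ Set.Icc a b, |f x - f y| ≤ c * |x - y|}

/-- Lipschitz norm ‖f‖_Lip = ‖f‖_∞ + Lip(f) on [a,b]. -/
noncomputable def lipNorm (a b : ℝ) (f : ℝ → ℝ) : ℝ := supOn a b f + lipC a b f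

/-- The transfer operator of a single map T_ω, written via its inverse branches. -/
noncomputable def Lone {Ω : Type*} {Z : Type*}
    (g g' : Z → Ω → ℝ → ℝ) (ω : Ω) (Φ : ℝ → ℝ) (x : ℝ) : ℝ :=
  ∑' z : Z, Φ (g z ω x) * |g' z ω x|

/-- The n-step transfer operator along a path [ω₀, …, ω_{n−1}]:
L_ω^n = L_{T_{ω_{n−1}}}∘…∘L_{T_{ω₀}}. -/
noncomputable def Lpath {Ω : Type*} {Z : Type*}
    (g g' : Z → Ω → ℝ → ℝ) (l : List Ω) (Φ : ℝ → ℝ) : ℝ → ℝ :=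
  l.foldl (fun Ψ ω => Lone g g' ω Ψ) Φ

/-- The annealed transfer operator. -/
noncomputable def Lop {Ω : Type*} [MeasurableSpace Ω] {Z : Type*}
    (P : Measure Ω) (g g' : Z → Ω → ℝ → ℝ) (Φ : ℝ → ℝ) (x : ℝ) : ℝ :=
  ∑' z : Z, ∫ ω, Φ (g z ω x) * |g' z ω x| ∂P



def Cone (a b A : ℝ) (f : ℝ → ℝ) (m : ℝ) : Prop :=
  (∀ x ∈ Icc a b, 0 ≤ f x) ∧
  (∀ x ∈ Icc a b, ∀ y ∈ Icc a b, f x ≤ Real.exp (A * |x - y|) * f y) ∧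
  (∫ x in Icc a b, f x) = m

lemma exp_sub_one_le (s : ℝ) : Real.exp s - 1 ≤ s * Real.exp s := by
  have h := Real.add_one_le_exp (-s)
  have h2 : Real.exp (-s) * Real.exp s = 1 := by rw [← Real.exp_add]; simp
  nlinarith [Real.exp_pos s]

lemma abs_sub_le_len {a b x y : ℝ} (hx : x ∈ Icc a b) (hy : y ∈ Icc a b) : |x - y| ≤ b - a := by
  rw [abs_le]; constructor <;> linarith [hx.1, hx.2, hy.1, hy.2]

lemma Cone.le_exp {a b A : ℝ} (hA : 0 < A) {f : ℝ → ℝ} {m : ℝ} (hf : Cone a b A f m)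
    {x y : ℝ} (hx : x ∈ Icc a b) (hy : y ∈ Icc a b) :
    f x ≤ Real.exp (A * (b - a)) * f y := by
  refine (hf.2.1 x hx y hy).trans ?_
  have := hf.1 y hy
  gcongr
  exact abs_sub_le_len hx hy

lemma Cone.lip_aux {a b A : ℝ} (hA : 0 < A) {f : ℝ → ℝ} {m : ℝ} (hf : Cone a b A f m)
    {U : ℝ} (hU : ∀ x ∈ Icc a b, f x ≤ U)
    {x y : ℝ} (hx : x ∈ Icc a b) (hy : y ∈ Icc a b) :
    f x - f y ≤ A * Real.exp (A * (b - a)) * U * |x - y| := by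
  have h1 := hf.2.1 x hx y hy
  have h2 := exp_sub_one_le (A * |x - y|)
  have h3 := hf.1 y hy
  have h4 := hU y hy
  have h5 := abs_sub_le_len hx hy
  have h6 : Real.exp (A * |x - y|) ≤ Real.exp (A * (b - a)) := by gcongr
  calc f x - f y ≤ (Real.exp (A * |x - y|) - 1) * f y := by linarith
    _ ≤ (A * |x - y| * Real.exp (A * |x - y|)) * f y := by gcongr
    _ ≤ (A * |x - y| * Real.exp (A * (b - a))) * U := by
        have := abs_nonneg (x - y); gcongr
    _ = _ := by ring

lemma Cone.lip {a b A : ℝ} (hA : 0 < A) {f : ℝ → ℝ} {m : ℝ} (hf : Cone a b A f m)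
    {U : ℝ} (hU : ∀ x ∈ Icc a b, f x ≤ U)
    {x y : ℝ} (hx : x ∈ Icc a b) (hy : y ∈ Icc a b) :
    |f x - f y| ≤ A * Real.exp (A * (b - a)) * U * |x - y| := by
  rw [abs_le]
  have h1 := hf.lip_aux hA hU hx hy
  have h2 := hf.lip_aux hA hU hy hx
  rw [abs_sub_comm] at h2
  constructor <;> linarith

lemma lipOn_of_abs {a b c : ℝ} {f : ℝ → ℝ}
    (h : ∀ x ∈ Icc a b, ∀ y ∈ Icc a b, |f x - f y| ≤ c * |x - y|) :
    LipschitzOnWith c.toNNReal f (Icc a b) := by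
  apply LipschitzOnWith.of_dist_le_mul
  intro x hx y hy
  rw [Real.dist_eq, Real.dist_eq]
  refine (h x hx y hy).trans ?_
  gcongr
  exact Real.le_coe_toNNReal c

lemma Cone.lipOn {a b A : ℝ} (hab : a < b) (hA : 0 < A) {f : ℝ → ℝ} {m : ℝ}
    (hf : Cone a b A f m) : ∃ c : NNReal, LipschitzOnWith c f (Icc a b) :=
  ⟨_, lipOn_of_abs (fun x hx y hy => hf.lip hA
    (U := Real.exp (A * (b - a)) * f a) (fun z hz => hf.le_exp hA hz ⟨le_rfl, hab.le⟩) hx hy)⟩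

lemma Cone.cont {a b A : ℝ} (hab : a < b) (hA : 0 < A) {f : ℝ → ℝ} {m : ℝ}
    (hf : Cone a b A f m) : ContinuousOn f (Icc a b) := by
  obtain ⟨c, hc⟩ := hf.lipOn hab hA
  exact hc.continuousOn

lemma Cone.nonneg {a b A : ℝ} {f : ℝ → ℝ} {m : ℝ} (hf : Cone a b A f m) : 0 ≤ m := by
  rw [← hf.2.2]
  exact setIntegral_nonneg measurableSet_Icc hf.1

lemma int_const {a b : ℝ} (hab : a < b) (c : ℝ) : (∫ _ in Icc a b, c) = c * (b - a) := by
  rw [setIntegral_const]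
  simp [hab.le, mul_comm]

lemma int_le_of_le {a b : ℝ} (hab : a < b) {f g : ℝ → ℝ}
    (hf : ContinuousOn f (Icc a b)) (hg : ContinuousOn g (Icc a b))
    (h : ∀ x ∈ Icc a b, f x ≤ g x) : (∫ x in Icc a b, f x) ≤ ∫ x in Icc a b, g x :=
  setIntegral_mono_on hf.integrableOn_Icc hg.integrableOn_Icc measurableSet_Icc h

lemma Cone.m_le {a b A : ℝ} (hab : a < b) (hA : 0 < A) {f : ℝ → ℝ} {m : ℝ}
    (hf : Cone a b A f m) {y : ℝ} (hy : y ∈ Icc a b) :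
    m ≤ Real.exp (A * (b - a)) * f y * (b - a) := by
  rw [← int_const hab, ← hf.2.2]
  exact int_le_of_le hab (hf.cont hab hA) continuousOn_const
    (fun x hx => hf.le_exp hA hx hy)

lemma Cone.le_m {a b A : ℝ} (hab : a < b) (hA : 0 < A) {f : ℝ → ℝ} {m : ℝ}
    (hf : Cone a b A f m) {x : ℝ} (hx : x ∈ Icc a b) :
    f x ≤ Real.exp (A * (b - a)) * m / (b - a) := by
  rw [le_div_iff₀ (by linarith), ← int_const hab, ← hf.2.2, ← integral_const_mul]
  exact int_le_of_le hab continuousOn_const (continuousOn_const.mul (hf.cont hab hA))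
    (fun y hy => hf.le_exp hA hx hy)

lemma Cone.mono {a b A B : ℝ} (hAB : B ≤ A) {f : ℝ → ℝ} {m : ℝ}
    (hf : Cone a b B f m) : Cone a b A f m := by
  refine ⟨hf.1, fun x hx y hy => (hf.2.1 x hx y hy).trans ?_, hf.2.2⟩
  have := hf.1 y hy
  gcongr

lemma cone_const {a b A : ℝ} (hab : a < b) (hA : 0 < A) {c : ℝ} (hc : 0 ≤ c) :
    Cone a b A (fun _ => c) (c * (b - a)) := by
  refine ⟨fun _ _ => hc, fun x _ y _ => ?_, int_const hab c⟩
  have : 1 ≤ Real.exp (A * |x - y|) := Real.one_le_exp (by positivity)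
  nlinarith

/-- Subtracting a small constant from a strictly more regular function. -/
lemma Cone.sub_const {a b A B D : ℝ} (hab : a < b) (hD : 0 < D) (hB : 0 < B) (hAB : B + D ≤ A)
    {f : ℝ → ℝ} {m k : ℝ} (hf : Cone a b B f m) (hk0 : 0 ≤ k) (hk : k ≤ m) :
    Cone a b A (fun x => f x - D / A * Real.exp (-(2 * A * (b - a))) * k / (b - a))
      (m - D / A * Real.exp (-(2 * A * (b - a))) * k) := by
  have hA : 0 < A := by linarith
  have hw : 0 < b - a := by linarith
  have hf' : Cone a b A f m := hf.mono (by linarith)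
  set δ := D / A * Real.exp (-(2 * A * (b - a))) with hδ
  have hδ0 : 0 < δ := by positivity
  set c := δ * k / (b - a) with hc
  have hc0 : 0 ≤ c := by positivity
  have hE : Real.exp (A * (b - a)) * Real.exp (A * (b - a)) * Real.exp (-(2 * A * (b - a))) = 1 := by
    rw [← Real.exp_add, ← Real.exp_add, Real.exp_eq_one_iff]; ring
  have hE1 : 1 ≤ Real.exp (A * (b - a)) := Real.one_le_exp (by positivity)
  set E := Real.exp (A * (b - a)) with hEdef
  have hkey : ∀ y ∈ Icc a b, c * (A * E) ≤ f y * D := by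
    intro y hy
    have h1 := hf'.m_le hab hA hy
    have h2 : k / (b - a) ≤ E * f y := by
      rw [div_le_iff₀ hw]; linarith
    calc c * (A * E) = (δ * A * E) * (k / (b - a)) := by rw [hc]; ring
      _ ≤ (δ * A * E) * (E * f y) := by gcongr
      _ = D * (E * E * Real.exp (-(2 * A * (b - a)))) * f y := by
          rw [hδ]; field_simp
      _ = f y * D := by rw [hE]; ring
  refine ⟨?_, ?_, ?_⟩
  · intro y hy
    have h1 := hkey y hy
    have h2 : D ≤ A * E := by nlinarith
    have h3 := hf.1 y hy
    have h4 : c * (A * E) ≤ f y * (A * E) := h1.trans (by gcongr)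
    have := le_of_mul_le_mul_right h4 (by positivity)
    linarith
  · intro x hx y hy
    have h1 := hkey y hy
    have h3 := hf.1 y hy
    have h2 := hf.2.1 x hx y hy
    set t := |x - y| with ht
    have ht0 : 0 ≤ t := abs_nonneg _
    have ht1 : t ≤ b - a := abs_sub_le_len hx hy
    have h4 : Real.exp (A * t) - 1 ≤ A * t * E := by
      refine (exp_sub_one_le _).trans ?_
      rw [hEdef]; gcongr
    have h5 : D * t ≤ Real.exp (A * t) - Real.exp (B * t) := by
      have e1 : Real.exp (A * t) = Real.exp (B * t) * Real.exp ((A - B) * t) := by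
        rw [← Real.exp_add]; ring_nf
      have e2 := Real.add_one_le_exp ((A - B) * t)
      have e3 : 1 ≤ Real.exp (B * t) := Real.one_le_exp (by positivity)
      have e4 : D * t ≤ (A - B) * t := by gcongr; linarith
      have e5 : 0 ≤ D * t := by positivity
      rw [e1]
      nlinarith
    have h6 : c * (Real.exp (A * t) - 1) ≤ f y * (Real.exp (A * t) - Real.exp (B * t)) :=
      calc c * (Real.exp (A * t) - 1) ≤ c * (A * t * E) := by gcongr
        _ = (c * (A * E)) * t := by ring
        _ ≤ f y * D * t := by gcongr
        _ = f y * (D * t) := by ring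
        _ ≤ _ := by gcongr
    change f x - c ≤ _ * (f y - c)
    linarith
  · rw [integral_sub (hf'.cont hab hA).integrableOn_Icc continuousOn_const.integrableOn_Icc,
      int_const hab, hf.2.2, hc]
    field_simp

/-- Abstract one-step properties of a transfer operator. -/
structure Good (a b A B : ℝ) (L : (ℝ → ℝ) → ℝ → ℝ) : Prop where
  congr : ∀ f g : ℝ → ℝ, EqOn f g (Icc a b) → EqOn (L f) (L g) (Icc a b)
  sub : ∀ f g : ℝ → ℝ, ContinuousOn f (Icc a b) → ContinuousOn g (Icc a b) →
    EqOn (L (fun x => f x - g x)) (fun x => L f x - L g x) (Icc a b)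
  cone : ∀ f m, Cone a b A f m → Cone a b B (L f) m

lemma pair_lemma {a b A B D : ℝ} (hab : a < b) (hD : 0 < D) (hB : 0 < B) (hAB : B + D ≤ A)
    (Ls : List ((ℝ → ℝ) → ℝ → ℝ)) (hL : ∀ L ∈ Ls, Good a b A B L) :
    ∀ (Φ f g : ℝ → ℝ) (m₁ m₂ : ℝ), Cone a b A f m₁ → Cone a b A g m₂ →
      EqOn Φ (fun x => f x - g x) (Icc a b) →
      ∃ f' g' m₁' m₂', Cone a b A f' m₁' ∧ Cone a b A g' m₂' ∧ m₁' - m₂' = m₁ - m₂ ∧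
        min m₁' m₂' = (1 - D / A * Real.exp (-(2 * A * (b - a)))) ^ Ls.length * min m₁ m₂ ∧
        EqOn (Ls.foldl (fun Ψ L => L Ψ) Φ) (fun x => f' x - g' x) (Icc a b) := by
  have hA : 0 < A := by linarith
  induction Ls with
  | nil =>
    intro Φ f g m₁ m₂ hf hg h
    exact ⟨f, g, m₁, m₂, hf, hg, rfl, by simp, h⟩
  | cons L Ls ih =>
    intro Φ f g m₁ m₂ hf hg h
    have hG := hL L (by simp)
    have hk0 : 0 ≤ min m₁ m₂ := le_min hf.nonneg hg.nonneg
    have h1 := (hG.cone f m₁ hf).sub_const hab hD hB hAB hk0 (min_le_left _ _)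
    have h2 := (hG.cone g m₂ hg).sub_const hab hD hB hAB hk0 (min_le_right _ _)
    obtain ⟨f', g', m₁', m₂', hf', hg', hm, hmin, he⟩ :=
      ih (fun L' hL' => hL L' (by simp [hL'])) (L Φ) _ _ _ _ h1 h2 (by
        intro x hx
        have e1 := hG.congr _ _ h hx
        have e2 := hG.sub f g (hf.cont hab hA) (hg.cont hab hA) hx
        simp only at e1 e2 ⊢
        rw [e1, e2]; ring)
    refine ⟨f', g', m₁', m₂', hf', hg', by rw [hm]; ring, ?_, he⟩
    rw [hmin, min_sub_sub_right, List.length_cons, pow_succ]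
    ring

lemma supOn_le {a b : ℝ} (hab : a < b) {f : ℝ → ℝ} {c : ℝ} (h : ∀ x ∈ Icc a b, |f x| ≤ c) :
    supOn a b f ≤ c := by
  haveI : Nonempty (Icc a b) := ⟨⟨a, le_rfl, hab.le⟩⟩
  exact ciSup_le (fun x => h x x.2)

lemma le_supOn {a b : ℝ} {f : ℝ → ℝ} (hf : ContinuousOn f (Icc a b)) {x : ℝ}
    (hx : x ∈ Icc a b) : |f x| ≤ supOn a b f := by
  have : BddAbove (range fun x : Icc a b => |f x|) := by
    obtain ⟨C, hC⟩ := isCompact_Icc.exists_bound_of_continuousOn hf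
    exact ⟨C, by rintro _ ⟨y, rfl⟩; exact hC y y.2⟩
  exact le_ciSup this ⟨x, hx⟩

lemma lipC_le {a b : ℝ} {f : ℝ → ℝ} {c : ℝ} (hc : 0 ≤ c)
    (h : ∀ x ∈ Icc a b, ∀ y ∈ Icc a b, |f x - f y| ≤ c * |x - y|) : lipC a b f ≤ c :=
  csInf_le ⟨0, fun _ h => h.1⟩ ⟨hc, h⟩

lemma lipC_nonneg {a b : ℝ} {f : ℝ → ℝ} : 0 ≤ lipC a b f :=
  Real.sInf_nonneg (fun _ h => h.1)

lemma le_lipC {a b : ℝ} {f : ℝ → ℝ} (hf : ∃ c : NNReal, LipschitzOnWith c f (Icc a b)) {x y : ℝ}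
    (hx : x ∈ Icc a b) (hy : y ∈ Icc a b) : |f x - f y| ≤ lipC a b f * |x - y| := by
  obtain ⟨c, hc⟩ := hf
  rcases eq_or_ne x y with rfl | hxy
  · simp
  have hpos : 0 < |x - y| := abs_pos.2 (sub_ne_zero.2 hxy)
  rw [← div_le_iff₀ hpos]
  apply le_csInf
  · refine ⟨c, c.2, fun x hx y hy => ?_⟩
    have := hc.dist_le_mul x hx y hy
    simpa [Real.dist_eq] using this
  · rintro d ⟨_, hd⟩
    rw [div_le_iff₀ hpos]
    exact hd x hx y hy

/-- Bound for a difference of two cone functions. -/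
lemma pair_bound {a b A : ℝ} (hab : a < b) (hA : 0 < A) {Ψ f g : ℝ → ℝ} {m₁ m₂ m : ℝ}
    (hf : Cone a b A f m₁) (hg : Cone a b A g m₂) (h1 : m₁ ≤ m) (h2 : m₂ ≤ m)
    (h : EqOn Ψ (fun x => f x - g x) (Icc a b)) :
    (∀ x ∈ Icc a b, |Ψ x| ≤ Real.exp (A * (b - a)) * m / (b - a)) ∧
    lipNorm a b Ψ ≤ 3 * (1 + A * Real.exp (A * (b - a))) * Real.exp (A * (b - a)) / (b - a) * m := by
  have hw : 0 < b - a := by linarith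
  set E := Real.exp (A * (b - a)) with hE
  have hm : 0 ≤ m := hf.nonneg.trans h1
  have bf : ∀ x ∈ Icc a b, f x ≤ E * m / (b - a) := fun x hx =>
    (hf.le_m hab hA hx).trans (by rw [← hE]; gcongr)
  have bg : ∀ x ∈ Icc a b, g x ≤ E * m / (b - a) := fun x hx =>
    (hg.le_m hab hA hx).trans (by rw [← hE]; gcongr)
  have hs : ∀ x ∈ Icc a b, |Ψ x| ≤ E * m / (b - a) := by
    intro x hx
    rw [h hx, abs_le]
    constructor <;> linarith [hf.1 x hx, hg.1 x hx, bf x hx, bg x hx]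
  refine ⟨hs, ?_⟩
  have hl : lipC a b Ψ ≤ 2 * (A * E * (E * m / (b - a))) := by
    apply lipC_le (by positivity)
    intro x hx y hy
    have e1 := hf.lip hA bf hx hy
    have e2 := hg.lip hA bg hx hy
    rw [h hx, h hy]
    have : (f x - g x) - (f y - g y) = (f x - f y) - (g x - g y) := by ring
    simp only [this]
    refine (abs_sub _ _).trans ?_
    rw [← hE] at e1 e2
    linarith
  have h0 := supOn_le hab hs
  unfold lipNorm
  have p1 : 0 ≤ E * m / (b - a) := by positivity
  have p2 : 0 ≤ A * E * (E * m / (b - a)) := by positivity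
  calc _ ≤ E * m / (b - a) + 2 * (A * E * (E * m / (b - a))) := add_le_add h0 hl
    _ ≤ 3 * (E * m / (b - a)) + 3 * (A * E * (E * m / (b - a))) := by linarith
    _ = _ := by ring

/-- Any Lipschitz function is a difference of cone functions. -/
lemma cone_decomp {a b A : ℝ} (hab : a < b) (hA : 0 < A) {Φ : ℝ → ℝ}
    (hΦ : ∃ c : NNReal, LipschitzOnWith c Φ (Icc a b)) :
    Cone a b A (fun x => Φ x + (supOn a b Φ + lipC a b Φ / A))
      ((∫ x in Icc a b, Φ x) + (supOn a b Φ + lipC a b Φ / A) * (b - a)) := by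
  have hc : ContinuousOn Φ (Icc a b) := by
    obtain ⟨c, hc⟩ := hΦ; exact hc.continuousOn
  have hl0 : 0 ≤ lipC a b Φ := lipC_nonneg
  have hlow : ∀ x ∈ Icc a b, lipC a b Φ / A ≤ Φ x + (supOn a b Φ + lipC a b Φ / A) := by
    intro x hx
    have := neg_le_of_abs_le (le_supOn hc hx)
    linarith
  refine ⟨fun x hx => le_trans (by positivity) (hlow x hx), fun x hx y hy => ?_, ?_⟩
  · have h1 := le_of_abs_le (le_lipC hΦ hx hy)
    have h2 := hlow y hy
    set F := Φ y + (supOn a b Φ + lipC a b Φ / A) with hF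
    have h3 : lipC a b Φ ≤ A * F := by
      rwa [div_le_iff₀ hA, mul_comm] at h2
    have h4 := Real.add_one_le_exp (A * |x - y|)
    have hF0 : 0 ≤ F := le_trans (by positivity) h2
    have h5 : lipC a b Φ * |x - y| ≤ A * F * |x - y| := by gcongr
    have h6 : (A * |x - y| + 1) * F ≤ Real.exp (A * |x - y|) * F := by gcongr
    linarith
  · rw [integral_add hc.integrableOn_Icc continuousOn_const.integrableOn_Icc, int_const hab]

lemma main_bound {a b A B D : ℝ} (hab : a < b) (hD : 0 < D) (hB : 0 < B) (hAB : B + D ≤ A)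
    (Ls : List ((ℝ → ℝ) → ℝ → ℝ)) (hL : ∀ L ∈ Ls, Good a b A B L) (Φ : ℝ → ℝ)
    (hΦ : ∃ c : NNReal, LipschitzOnWith c Φ (Icc a b)) :
    lipNorm a b (Ls.foldl (fun Ψ L => L Ψ) Φ) ≤
      3 * (1 + A * Real.exp (A * (b - a))) * Real.exp (A * (b - a)) / (b - a) *
      ((1 - D / A * Real.exp (-(2 * A * (b - a)))) ^ Ls.length *
        ((1 + 1 / A) * (b - a) * lipNorm a b Φ) + |∫ x in Icc a b, Φ x|) := by
  have hA : 0 < A := by linarith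
  have hw : 0 < b - a := by linarith
  have hl0 : 0 ≤ lipC a b Φ := lipC_nonneg
  have hs0 : 0 ≤ supOn a b Φ := by
    have hc : ContinuousOn Φ (Icc a b) := by
      obtain ⟨c, hc⟩ := hΦ; exact hc.continuousOn
    exact (abs_nonneg _).trans (le_supOn hc (left_mem_Icc.2 hab.le))
  have h1 := cone_decomp hab hA hΦ
  set c := supOn a b Φ + lipC a b Φ / A with hcdef
  have hc0 : 0 ≤ c := by positivity
  have h2 := cone_const hab hA hc0
  obtain ⟨f', g', m₁', m₂', hf', hg', hm, hmin, he⟩ :=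
    pair_lemma hab hD hB hAB Ls hL Φ _ _ _ _ h1 h2 (fun x _ => by simp)
  set I := ∫ x in Icc a b, Φ x with hI
  have hρ : 0 ≤ 1 - D / A * Real.exp (-(2 * A * (b - a))) := by
    have e1 : D / A ≤ 1 := by rw [div_le_one hA]; linarith
    have e2 : Real.exp (-(2 * A * (b - a))) ≤ 1 := by
      rw [Real.exp_le_one_iff]; nlinarith [mul_pos hA hw]
    have e3 : 0 < D / A := by positivity
    nlinarith [Real.exp_pos (-(2 * A * (b - a)))]
  set ρ := (1 - D / A * Real.exp (-(2 * A * (b - a)))) ^ Ls.length with hρd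
  have hρ0 : 0 ≤ ρ := pow_nonneg hρ _
  have hcl : c ≤ (1 + 1 / A) * lipNorm a b Φ := by
    unfold lipNorm
    have : 0 ≤ 1 / A * supOn a b Φ := by positivity
    have e : lipC a b Φ / A = 1 / A * lipC a b Φ := by ring
    rw [hcdef, e]
    linarith
  have hmin2 : min m₁' m₂' ≤ ρ * ((1 + 1 / A) * (b - a) * lipNorm a b Φ) := by
    rw [hmin]
    gcongr
    refine (min_le_right _ _).trans ?_
    calc c * (b - a) ≤ (1 + 1 / A) * lipNorm a b Φ * (b - a) := by gcongr
      _ = _ := by ring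
  have hm' : m₁' - m₂' = I := by rw [hm]; ring
  have hIa := abs_le.1 (le_refl |I|)
  refine (pair_bound hab hA hf' hg' (m := ρ * ((1 + 1 / A) * (b - a) * lipNorm a b Φ) + |I|)
    ?_ ?_ he).2
  · rcases min_choice m₁' m₂' with h | h <;> rw [h] at hmin2 <;> linarith
  · rcases min_choice m₁' m₂' with h | h <;> rw [h] at hmin2 <;> linarith


lemma foldl_replicate_iter (L : (ℝ → ℝ) → ℝ → ℝ) (n : ℕ) :
    ∀ Φ, (List.replicate n L).foldl (fun Ψ L => L Ψ) Φ = L^[n] Φ := by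
  induction n with
  | zero => intro Φ; rfl
  | succ n ih => intro Φ; rw [List.replicate_succ, List.foldl_cons, ih]; rfl

lemma Good.iter_congr {a b A B : ℝ} {L : (ℝ → ℝ) → ℝ → ℝ} (hG : Good a b A B L) (n : ℕ) :
    ∀ f g, EqOn f g (Icc a b) → EqOn (L^[n] f) (L^[n] g) (Icc a b) := by
  induction n with
  | zero => intro f g h; exact h
  | succ n ih => intro f g h; exact ih _ _ (hG.congr _ _ h)

lemma Good.cone' {a b A B : ℝ} (hBA : B ≤ A) {L : (ℝ → ℝ) → ℝ → ℝ} (hG : Good a b A B L)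
    {f : ℝ → ℝ} {m : ℝ} (hf : Cone a b A f m) : Cone a b A (L f) m :=
  (hG.cone f m hf).mono hBA

lemma Good.iter_sub {a b A B : ℝ} (hab : a < b) (hA : 0 < A) (hBA : B ≤ A)
    {L : (ℝ → ℝ) → ℝ → ℝ} (hG : Good a b A B L) (n : ℕ) :
    ∀ f g m₁ m₂, Cone a b A f m₁ → Cone a b A g m₂ →
    EqOn (L^[n] (fun x => f x - g x)) (fun x => L^[n] f x - L^[n] g x) (Icc a b) := by
  induction n with
  | zero => intro f g m₁ m₂ _ _ x _; rfl
  | succ n ih =>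
    intro f g m₁ m₂ hf hg
    exact (hG.iter_congr n _ _ (hG.sub f g (hf.cont hab hA) (hg.cont hab hA))).trans
      (ih _ _ m₁ m₂ (hG.cone' hBA hf) (hG.cone' hBA hg))

lemma Good.iter_cone {a b A B : ℝ} (hBA : B ≤ A)
    {L : (ℝ → ℝ) → ℝ → ℝ} (hG : Good a b A B L) (n : ℕ) :
    ∀ f m, Cone a b A f m → Cone a b A (L^[n] f) m := by
  induction n with
  | zero => intro f m h; exact h
  | succ n ih => intro f m h; exact ih _ _ (hG.cone' hBA h)

lemma rho_bounds {a b A D : ℝ} (hab : a < b) (hD : 0 < D) (hDA : D ≤ A) :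
    0 ≤ 1 - D / A * Real.exp (-(2 * A * (b - a))) ∧
    1 - D / A * Real.exp (-(2 * A * (b - a))) < 1 := by
  have hA : 0 < A := by linarith
  have hw : 0 < b - a := by linarith
  have e1 : D / A ≤ 1 := by rw [div_le_one hA]; linarith
  have e2 : Real.exp (-(2 * A * (b - a))) ≤ 1 := by
    rw [Real.exp_le_one_iff]; nlinarith [mul_pos hA hw]
  have e3 : 0 < D / A := by positivity
  have e4 := Real.exp_pos (-(2 * A * (b - a)))
  constructor <;> nlinarith

lemma stationary {a b A B D K : ℝ} (hab : a < b) (hD : 0 < D) (hB : 0 < B) (hAB : B + D ≤ A)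
    {L : (ℝ → ℝ) → ℝ → ℝ} (hG : Good a b A B L)
    (hK : ∀ (f : ℝ → ℝ) (s : ℝ), ContinuousOn f (Icc a b) → (∀ x ∈ Icc a b, |f x| ≤ s) →
      ∀ x ∈ Icc a b, |L f x| ≤ K * s) :
    ∃ h : ℝ → ℝ, Cone a b A h (b - a) ∧ ∀ x ∈ Icc a b, L h x = h x := by
  have hA : 0 < A := by linarith
  have hBA : B ≤ A := by linarith
  have hw : 0 < b - a := by linarith
  obtain ⟨hρ0, hρ1⟩ := rho_bounds hab hD (show D ≤ A by linarith)
  set ρ := 1 - D / A * Real.exp (-(2 * A * (b - a))) with hρ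
  set E := Real.exp (A * (b - a)) with hE
  have h1 : Cone a b A (fun _ => (1:ℝ)) (b - a) := by
    have := cone_const hab hA (zero_le_one' ℝ)
    rwa [one_mul] at this
  set u : ℕ → ℝ → ℝ := fun n => L^[n] (fun _ => (1:ℝ)) with hu
  have hcone : ∀ n, Cone a b A (u n) (b - a) := fun n => hG.iter_cone hBA n _ _ h1
  have hdiff : ∀ n k, ∀ x ∈ Icc a b, |u (n + k) x - u n x| ≤ E * ρ ^ n := by
    intro n k x hx
    obtain ⟨f', g', m₁', m₂', hf', hg', hm, hmin, he⟩ :=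
      pair_lemma hab hD hB hAB (List.replicate n L)
        (fun L' hL' => by rw [List.eq_of_mem_replicate hL']; exact hG)
        (fun x => u k x - 1) _ _ _ _ (hcone k) h1 (fun x _ => rfl)
    rw [foldl_replicate_iter] at he
    rw [List.length_replicate, min_self] at hmin
    have hmm : m₁' = m₂' := by linarith
    have hsub := hG.iter_sub hab hA hBA n _ _ _ _ (hcone k) h1
    have e := (pair_bound hab hA hf' hg' (m := ρ ^ n * (b - a))
      (by rw [← hmin, hmm, min_self]) (by rw [← hmin, hmm, min_self]) he).1 x hx
    rw [hsub hx] at e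
    have e2 : u (n + k) x = L^[n] (u k) x := by
      simp only [hu]; rw [Function.iterate_add_apply]
    rw [e2]
    refine e.trans (le_of_eq ?_)
    rw [hE]
    field_simp
  have htend : Tendsto (fun n => E * ρ ^ n) atTop (𝓝 0) := by
    simpa using (tendsto_pow_atTop_nhds_zero_of_lt_one hρ0 hρ1).const_mul E
  have hcau : ∀ x ∈ Icc a b, CauchySeq (fun n => u n x) := by
    intro x hx
    apply cauchySeq_of_le_tendsto_0' (fun n => E * ρ ^ n) _ htend
    intro n m hnm
    obtain ⟨k, rfl⟩ := Nat.exists_eq_add_of_le hnm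
    rw [dist_comm, Real.dist_eq]
    exact hdiff n k x hx
  have hlim : ∀ x, ∃ l, x ∈ Icc a b → Tendsto (fun n => u n x) atTop (𝓝 l) := by
    intro x
    by_cases hx : x ∈ Icc a b
    · obtain ⟨l, hl⟩ := cauchySeq_tendsto_of_complete (hcau x hx)
      exact ⟨l, fun _ => hl⟩
    · exact ⟨0, fun h => absurd h hx⟩
  choose h hh using hlim
  have hbd : ∀ n, ∀ x ∈ Icc a b, |h x - u n x| ≤ E * ρ ^ n := by
    intro n x hx
    have t1 : Tendsto (fun k => |u (n + k) x - u n x|) atTop (𝓝 |h x - u n x|) := by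
      have := (hh x hx).comp (tendsto_add_atTop_nat n)
      have := (this.sub_const (u n x)).abs
      refine this.congr (fun k => ?_)
      simp [Function.comp, add_comm]
    exact le_of_tendsto' t1 (fun k => hdiff n k x hx)
  have hc0 : ∀ x ∈ Icc a b, 0 ≤ h x := fun x hx =>
    ge_of_tendsto' (hh x hx) (fun n => (hcone n).1 x hx)
  have hc1 : ∀ x ∈ Icc a b, ∀ y ∈ Icc a b, h x ≤ Real.exp (A * |x - y|) * h y :=
    fun x hx y hy => le_of_tendsto_of_tendsto' (hh x hx) ((hh y hy).const_mul _)
      (fun n => (hcone n).2.1 x hx y hy)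
  have hcont : ContinuousOn h (Icc a b) :=
    Cone.cont (m := ∫ x in Icc a b, h x) hab hA ⟨hc0, hc1, rfl⟩
  have hIntEq : (∫ x in Icc a b, h x) = b - a := by
    have ht : Tendsto (fun n => ∫ x in Icc a b, u n x) atTop (𝓝 (∫ x in Icc a b, h x)) := by
      apply tendsto_integral_of_dominated_convergence (fun _ => E)
      · intro n
        exact ((hcone n).cont hab hA).aestronglyMeasurable measurableSet_Icc
      · exact continuousOn_const.integrableOn_Icc
      · intro n
        refine (ae_restrict_iff' measurableSet_Icc).2 (Eventually.of_forall fun x hx => ?_)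
        rw [Real.norm_eq_abs, abs_of_nonneg ((hcone n).1 x hx)]
        have := (hcone n).le_m hab hA hx
        rwa [mul_div_assoc, div_self hw.ne', mul_one] at this
      · exact (ae_restrict_iff' measurableSet_Icc).2 (Eventually.of_forall hh)
    have : (fun n => ∫ x in Icc a b, u n x) = fun _ => b - a := funext fun n => (hcone n).2.2
    rw [this] at ht
    exact tendsto_nhds_unique ht tendsto_const_nhds
  refine ⟨h, ⟨hc0, hc1, hIntEq⟩, fun x hx => ?_⟩
  have t2 : Tendsto (fun n => u (n + 1) x) atTop (𝓝 (L h x)) := by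
    rw [← tendsto_sub_nhds_zero_iff]
    apply squeeze_zero_norm (a := fun n => K * (E * ρ ^ n)) _ (by simpa using htend.const_mul K)
    intro n
    have e := hK (fun x => h x - u n x) _ (hcont.sub ((hcone n).cont hab hA)) (hbd n) x hx
    rw [hG.sub h (u n) hcont ((hcone n).cont hab hA) hx] at e
    have e2 : u (n + 1) x = L (u n) x := by
      simp only [hu]; rw [Function.iterate_succ_apply']
    rw [Real.norm_eq_abs, abs_sub_comm, e2]
    exact e
  exact tendsto_nhds_unique t2 ((tendsto_add_atTop_iff_nat 1).2 (hh x hx))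


structure Sys {Ω : Type*} [MeasurableSpace Ω] {Z : Type*} (a b Dt β : ℝ)
    (g g' : Z → Ω → ℝ → ℝ) : Prop where
  hab : a < b
  hg1 : ∀ z ω, ∀ x ∈ Icc a b, HasDerivWithinAt (g z ω) (g' z ω x) (Icc a b) x
  hgc : ∀ z ω, ContinuousOn (g' z ω) (Icc a b)
  hmaps : ∀ z ω, MapsTo (g z ω) (Icc a b) (Icc a b)
  hinj : ∀ z ω, InjOn (g z ω) (Icc a b)
  hdisj : ∀ ω : Ω, Pairwise fun z z' : Z =>
      Disjoint (interior (g z ω '' Icc a b)) (interior (g z' ω '' Icc a b))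
  hfull : ∀ ω, volume ((Icc a b) \ ⋃ z : Z, g z ω '' Icc a b) = 0
  hmeas : ∀ z x, Measurable (fun ω => g z ω x) ∧ Measurable fun ω => g' z ω x
  hDt : 0 < Dt
  hdist : ∀ z ω, ∀ x ∈ Icc a b, ∀ y ∈ Icc a b, |g' z ω x / g' z ω y - 1| ≤ Dt * |x - y|
  hβ : β ∈ Ioo (0:ℝ) 1
  hA2 : ∀ z ω, ∀ x ∈ Icc a b, |g' z ω x| ≤ β

section sys
set_option linter.unusedSectionVars false
variable {Ω : Type*} [MeasurableSpace Ω] {Z : Type*} [Countable Z] {a b Dt β : ℝ}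
  {g g' : Z → Ω → ℝ → ℝ}

lemma Sys.g'_ne (S : Sys a b Dt β g g') (z : Z) (ω : Ω) {y : ℝ} (hy : y ∈ Icc a b) :
    g' z ω y ≠ 0 := by
  intro h0
  have := S.hdist z ω y hy y hy
  rw [h0] at this
  norm_num at this

lemma Sys.dist_exp (S : Sys a b Dt β g g') (z : Z) (ω : Ω) {x y : ℝ} (hx : x ∈ Icc a b)
    (hy : y ∈ Icc a b) : |g' z ω x| ≤ Real.exp (Dt * |x - y|) * |g' z ω y| := by
  have h := S.hdist z ω x hx y hy
  have h0 : g' z ω y ≠ 0 := by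
    intro h0
    have := S.hdist z ω y hy y hy
    rw [h0] at this
    norm_num at this
  have h1 : |g' z ω x / g' z ω y| ≤ 1 + Dt * |x - y| := by
    have e : g' z ω x / g' z ω y = (g' z ω x / g' z ω y - 1) + 1 := by ring
    rw [e]
    refine (abs_add_le _ _).trans ?_
    rw [abs_one]; linarith
  rw [abs_div, div_le_iff₀ (abs_pos.2 h0)] at h1
  refine h1.trans ?_
  gcongr
  linarith [Real.add_one_le_exp (Dt * |x - y|)]

lemma Sys.g_lip (S : Sys a b Dt β g g') (z : Z) (ω : Ω) {x y : ℝ} (hx : x ∈ Icc a b)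
    (hy : y ∈ Icc a b) : |g z ω x - g z ω y| ≤ β * |x - y| :=
  Convex.norm_image_sub_le_of_norm_hasDerivWithin_le (S.hg1 z ω) (S.hA2 z ω)
    (convex_Icc a b) hy hx

lemma Sys.g_cont (S : Sys a b Dt β g g') (z : Z) (ω : Ω) : ContinuousOn (g z ω) (Icc a b) :=
  fun x hx => (S.hg1 z ω x hx).continuousWithinAt

lemma Sys.proj_meas (S : Sys a b Dt β g g') (z : Z) :
    Measurable (Function.uncurry fun (x : ℝ) (ω : Ω) => g z ω (projIcc a b S.hab.le x)) ∧
    Measurable (Function.uncurry fun (x : ℝ) (ω : Ω) => g' z ω (projIcc a b S.hab.le x)) := by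
  constructor
  · apply measurable_uncurry_of_continuous_of_measurable
    · intro ω
      exact (continuousOn_iff_continuous_domRestrict.1 (S.g_cont z ω)).comp continuous_projIcc
    · intro x; exact (S.hmeas z _).1
  · apply measurable_uncurry_of_continuous_of_measurable
    · intro ω
      exact (continuousOn_iff_continuous_domRestrict.1 (S.hgc z ω)).comp continuous_projIcc
    · intro x; exact (S.hmeas z _).2

/-- change of variables for a single map -/
lemma Sys.cov (S : Sys a b Dt β g g') (ω : Ω) (φ : ℝ → ENNReal) :
    ∑' z, ∫⁻ x in Icc a b, ENNReal.ofReal |g' z ω x| * φ (g z ω x) = ∫⁻ x in Icc a b, φ x := by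
  have hcpt : ∀ z, IsCompact (g z ω '' Icc a b) := fun z =>
    isCompact_Icc.image_of_continuousOn (S.g_cont z ω)
  have hconv : ∀ z, Convex ℝ (g z ω '' Icc a b) := fun z => by
    rw [convex_iff_ordConnected]
    exact (isPreconnected_Icc.image _ (S.g_cont z ω)).ordConnected
  have hdis : Pairwise (Function.onFun (AEDisjoint volume) (fun z => g z ω '' Icc a b)) := by
    intro z z' hz
    have h1 := (hconv z).addHaar_frontier volume
    have h2 := (hconv z').addHaar_frontier volume
    refine measure_mono_null ?_ (measure_union_null h1 h2)
    rintro x ⟨hx1, hx2⟩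
    by_contra hcon
    simp only [mem_union, not_or, frontier, Set.mem_sdiff, not_and, not_not] at hcon
    exact Set.disjoint_left.1 (S.hdisj ω hz) (hcon.1 (subset_closure hx1))
      (hcon.2 (subset_closure hx2))
  have h1 : ∀ z, ∫⁻ x in Icc a b, ENNReal.ofReal |g' z ω x| * φ (g z ω x)
      = ∫⁻ x in g z ω '' Icc a b, φ x := fun z =>
    (lintegral_image_eq_lintegral_abs_deriv_mul measurableSet_Icc (S.hg1 z ω) (S.hinj z ω) φ).symm
  simp_rw [h1]
  rw [← lintegral_iUnion₀ (fun z => (hcpt z).measurableSet.nullMeasurableSet) hdis]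
  apply setLIntegral_congr
  refine (LE.le.eventuallyLE ?_).antisymm ?_
  · exact iUnion_subset fun z => (S.hmaps z ω).image_subset
  · rw [ae_le_set]; exact S.hfull ω

/-- pointwise bound of the sum of derivatives -/
lemma Sys.sum_le (S : Sys a b Dt β g g') (ω : Ω) {x : ℝ} (hx : x ∈ Icc a b) :
    ∑' z, ENNReal.ofReal |g' z ω x| ≤ ENNReal.ofReal (Real.exp (Dt * (b - a))) := by
  have hab := S.hab
  have hw : 0 < b - a := by linarith
  have hcov := S.cov ω (fun _ => 1)
  simp only [mul_one, lintegral_const, one_mul, Measure.restrict_apply_univ, Real.volume_Icc]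
    at hcov
  have h1 : ∀ z, ENNReal.ofReal |g' z ω x| * ENNReal.ofReal (b - a) ≤
      ENNReal.ofReal (Real.exp (Dt * (b - a))) *
        ∫⁻ x in Icc a b, ENNReal.ofReal |g' z ω x| := by
    intro z
    rw [← lintegral_const_mul' _ _ ENNReal.ofReal_ne_top]
    calc ENNReal.ofReal |g' z ω x| * ENNReal.ofReal (b - a)
        = ∫⁻ y in Icc a b, ENNReal.ofReal |g' z ω x| := by simp
      _ ≤ _ := by
        apply setLIntegral_mono' measurableSet_Icc
        intro y hy
        rw [← ENNReal.ofReal_mul (Real.exp_pos _).le]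
        apply ENNReal.ofReal_le_ofReal
        refine (S.dist_exp z ω hx hy).trans ?_
        have := abs_sub_le_len hx hy
        have := S.hDt
        gcongr
  have h2 := ENNReal.tsum_le_tsum h1
  rw [ENNReal.tsum_mul_right, ENNReal.tsum_mul_left, hcov] at h2
  exact (ENNReal.mul_le_mul_iff_left (by simpa using hab) ENNReal.ofReal_ne_top).1 h2

variable (Q : Measure Ω) [IsProbabilityMeasure Q]

lemma Sys.dual (S : Sys a b Dt β g g') {φ : ℝ → ENNReal} (hφ : Measurable φ) :
    ∫⁻ x in Icc a b, ∑' z, ∫⁻ ω, ENNReal.ofReal |g' z ω x| * φ (g z ω x) ∂Q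
      = ∫⁻ x in Icc a b, φ x := by
  have hab := S.hab
  have hm : ∀ z, Measurable (Function.uncurry fun (x : ℝ) (ω : Ω) =>
      ENNReal.ofReal |g' z ω (projIcc a b S.hab.le x)| * φ (g z ω (projIcc a b S.hab.le x))) := by
    intro z
    obtain ⟨h1, h2⟩ := S.proj_meas z
    exact (ENNReal.measurable_ofReal.comp (continuous_abs.measurable.comp h2)).mul (hφ.comp h1)
  have hproj : ∀ x ∈ Icc a b, ((projIcc a b S.hab.le x : Icc a b) : ℝ) = x := by
    intro x hx; rw [projIcc_of_mem _ hx]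
  calc ∫⁻ x in Icc a b, ∑' z, ∫⁻ ω, ENNReal.ofReal |g' z ω x| * φ (g z ω x) ∂Q
      = ∫⁻ x in Icc a b, ∑' z, ∫⁻ ω, ENNReal.ofReal |g' z ω (projIcc a b S.hab.le x)| *
          φ (g z ω (projIcc a b S.hab.le x)) ∂Q := by
        apply setLIntegral_congr_fun measurableSet_Icc
        intro x hx
        simp only [hproj x hx]
    _ = ∑' z, ∫⁻ x in Icc a b, ∫⁻ ω, ENNReal.ofReal |g' z ω (projIcc a b S.hab.le x)| *
          φ (g z ω (projIcc a b S.hab.le x)) ∂Q := by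
        apply lintegral_tsum
        intro z
        exact (Measurable.lintegral_prod_right' (hm z)).aemeasurable
    _ = ∑' z, ∫⁻ ω, ∫⁻ x in Icc a b, ENNReal.ofReal |g' z ω (projIcc a b S.hab.le x)| *
          φ (g z ω (projIcc a b S.hab.le x)) ∂volume ∂Q := by
        congr 1; ext z
        exact lintegral_lintegral_swap (hm z).aemeasurable
    _ = ∫⁻ ω, ∑' z, ∫⁻ x in Icc a b, ENNReal.ofReal |g' z ω (projIcc a b S.hab.le x)| *
          φ (g z ω (projIcc a b S.hab.le x)) ∂volume ∂Q := by
        rw [lintegral_tsum]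
        intro z
        exact (Measurable.lintegral_prod_left' (hm z)).aemeasurable
    _ = ∫⁻ ω, (∫⁻ x in Icc a b, φ x) ∂Q := by
        congr 1; ext ω
        rw [← S.cov ω φ]
        congr 1; ext z
        apply setLIntegral_congr_fun measurableSet_Icc
        intro x hx
        simp only [hproj x hx]
    _ = _ := by simp

lemma Sys.sum_int_le (S : Sys a b Dt β g g') {x : ℝ} (hx : x ∈ Icc a b) :
    ∑' z, ∫⁻ ω, ENNReal.ofReal |g' z ω x| ∂Q ≤ ENNReal.ofReal (Real.exp (Dt * (b - a))) := by
  have hm : ∀ z, AEMeasurable (fun ω => ENNReal.ofReal |g' z ω x|) Q := fun z =>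
    (ENNReal.measurable_ofReal.comp (continuous_abs.measurable.comp (S.hmeas z x).2)).aemeasurable
  rw [← lintegral_tsum hm]
  calc _ ≤ ∫⁻ _, ENNReal.ofReal (Real.exp (Dt * (b - a))) ∂Q :=
        lintegral_mono (fun ω => S.sum_le ω hx)
    _ = _ := by simp

/-- measurability of the integrand, for f continuous on the interval -/
lemma Sys.F_meas (S : Sys a b Dt β g g') {f : ℝ → ℝ} (hf : ContinuousOn f (Icc a b)) (z : Z)
    {x : ℝ} (hx : x ∈ Icc a b) : Measurable (fun ω => f (g z ω x) * |g' z ω x|) := by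
  have h1 : (fun ω => f (g z ω x)) = fun ω => IccExtend S.hab.le (domRestrict (Icc a b) f) (g z ω x) := by
    ext ω
    rw [IccExtend_of_mem _ _ (S.hmaps z ω hx)]; rfl
  have h2 : Continuous (IccExtend S.hab.le (domRestrict (Icc a b) f)) :=
    (continuousOn_iff_continuous_domRestrict.1 hf).Icc_extend'
  apply Measurable.mul
  · rw [h1]
    exact h2.measurable.comp (S.hmeas z x).1
  · exact continuous_abs.measurable.comp (S.hmeas z x).2

lemma Sys.F_int (S : Sys a b Dt β g g') {f : ℝ → ℝ} (hf : ContinuousOn f (Icc a b)) (z : Z)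
    {x : ℝ} (hx : x ∈ Icc a b) : Integrable (fun ω => f (g z ω x) * |g' z ω x|) Q := by
  obtain ⟨C, hC⟩ := isCompact_Icc.exists_bound_of_continuousOn hf
  refine Integrable.of_bound (S.F_meas hf z hx).aestronglyMeasurable (C * β)
    (Eventually.of_forall fun ω => ?_)
  rw [norm_mul, Real.norm_eq_abs |_|, abs_abs]
  have h1 := hC _ (S.hmaps z ω hx)
  have h2 := S.hA2 z ω x hx
  have := norm_nonneg (f (g z ω x))
  gcongr
  linarith

lemma Sys.g'_int (S : Sys a b Dt β g g') (z : Z)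
    {x : ℝ} (hx : x ∈ Icc a b) : Integrable (fun ω => |g' z ω x|) Q := by
  have := S.F_int Q (f := fun _ => 1) continuousOn_const z hx
  simpa using this

lemma Sys.g'_sum (S : Sys a b Dt β g g') {x : ℝ} (hx : x ∈ Icc a b) :
    Summable (fun z => ∫ ω, |g' z ω x| ∂Q) ∧
    ∑' z, ∫ ω, |g' z ω x| ∂Q ≤ Real.exp (Dt * (b - a)) := by
  have h := S.sum_int_le Q hx
  have h1 : ∀ z, ∫⁻ ω, ENNReal.ofReal |g' z ω x| ∂Q = ENNReal.ofReal (∫ ω, |g' z ω x| ∂Q) := fun z =>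
    (ofReal_integral_eq_lintegral_ofReal (S.g'_int Q z hx)
      (Eventually.of_forall fun ω => abs_nonneg _)).symm
  have h0 : ∀ z, 0 ≤ ∫ ω, |g' z ω x| ∂Q := fun z => integral_nonneg fun ω => abs_nonneg _
  simp_rw [h1] at h
  have hs : Summable (fun z => ∫ ω, |g' z ω x| ∂Q) := by
    have := ENNReal.summable_toReal (ne_top_of_le_ne_top ENNReal.ofReal_ne_top h)
    refine this.congr (fun z => ?_)
    rw [ENNReal.toReal_ofReal (h0 z)]
  refine ⟨hs, ?_⟩
  rw [← ENNReal.ofReal_tsum_of_nonneg h0 hs] at h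
  exact (ENNReal.ofReal_le_ofReal_iff (Real.exp_pos _).le).1 h

lemma Sys.F_bound (S : Sys a b Dt β g g') {f : ℝ → ℝ} {s : ℝ}
    (hs : ∀ x ∈ Icc a b, |f x| ≤ s) (z : Z) {x : ℝ} (hx : x ∈ Icc a b) :
    ‖∫ ω, f (g z ω x) * |g' z ω x| ∂Q‖ ≤ s * ∫ ω, |g' z ω x| ∂Q := by
  rw [← integral_const_mul]
  apply norm_integral_le_of_norm_le ((S.g'_int Q z hx).const_mul s)
  refine Eventually.of_forall fun ω => ?_
  rw [norm_mul, Real.norm_eq_abs |_|, abs_abs]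
  have := hs _ (S.hmaps z ω hx)
  gcongr
  exact this

lemma Sys.F_sum (S : Sys a b Dt β g g') {f : ℝ → ℝ} (hf : ContinuousOn f (Icc a b))
    {x : ℝ} (hx : x ∈ Icc a b) : Summable (fun z => ∫ ω, f (g z ω x) * |g' z ω x| ∂Q) := by
  obtain ⟨C, hC⟩ := isCompact_Icc.exists_bound_of_continuousOn hf
  exact Summable.of_norm_bounded ((S.g'_sum Q hx).1.mul_left C)
    (fun z => S.F_bound Q hC z hx)

lemma Sys.Lop_bound (S : Sys a b Dt β g g') (f : ℝ → ℝ) (s : ℝ)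
    (_ : ContinuousOn f (Icc a b))
    (hs : ∀ x ∈ Icc a b, |f x| ≤ s) (x : ℝ) (hx : x ∈ Icc a b) :
    |Lop Q g g' f x| ≤ Real.exp (Dt * (b - a)) * s := by
  have hs0 : 0 ≤ s := (abs_nonneg _).trans (hs x hx)
  have h := tsum_of_norm_bounded ((S.g'_sum Q hx).1.mul_left s).hasSum
    (fun z => S.F_bound Q hs z hx)
  rw [tsum_mul_left] at h
  unfold Lop
  rw [← Real.norm_eq_abs]
  refine h.trans ?_
  rw [mul_comm]
  gcongr
  exact (S.g'_sum Q hx).2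

lemma Sys.Lop_congr (S : Sys a b Dt β g g') (f f₂ : ℝ → ℝ) (h : EqOn f f₂ (Icc a b)) :
    EqOn (Lop Q g g' f) (Lop Q g g' f₂) (Icc a b) := by
  intro x hx
  unfold Lop
  congr 1; ext z
  congr 1; ext ω
  rw [h (S.hmaps z ω hx)]

lemma Sys.Lop_sub (S : Sys a b Dt β g g') (f f₂ : ℝ → ℝ) (hf : ContinuousOn f (Icc a b))
    (hf₂ : ContinuousOn f₂ (Icc a b)) :
    EqOn (Lop Q g g' (fun x => f x - f₂ x)) (fun x => Lop Q g g' f x - Lop Q g g' f₂ x)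
      (Icc a b) := by
  intro x hx
  simp only [Lop]
  rw [← (S.F_sum Q hf hx).tsum_sub (S.F_sum Q hf₂ hx)]
  congr 1; ext z
  rw [← integral_sub (S.F_int Q hf z hx) (S.F_int Q hf₂ z hx)]
  congr 1; ext ω
  ring

lemma Sys.Lop_exp (S : Sys a b Dt β g g') {A m : ℝ} (hA : 0 < A) {f : ℝ → ℝ}
    (hf : Cone a b A f m) {x y : ℝ} (hx : x ∈ Icc a b) (hy : y ∈ Icc a b) :
    Lop Q g g' f x ≤ Real.exp ((β * A + Dt) * |x - y|) * Lop Q g g' f y := by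
  have hc := hf.cont S.hab hA
  unfold Lop
  rw [← tsum_mul_left]
  refine (S.F_sum Q hc hx).tsum_le_tsum (fun z => ?_) ((S.F_sum Q hc hy).mul_left _)
  rw [← integral_const_mul]
  refine integral_mono (S.F_int Q hc z hx) ((S.F_int Q hc z hy).const_mul _) (fun ω => ?_)
  have h1 := hf.2.1 _ (S.hmaps z ω hx) _ (S.hmaps z ω hy)
  have h2 := S.dist_exp z ω hx hy
  have h3 := S.g_lip z ω hx hy
  have h4 := hf.1 _ (S.hmaps z ω hy)
  have h5 := hf.1 _ (S.hmaps z ω hx)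
  calc f (g z ω x) * |g' z ω x|
      ≤ (Real.exp (A * (β * |x - y|)) * f (g z ω y)) *
        (Real.exp (Dt * |x - y|) * |g' z ω y|) := by
        refine mul_le_mul (h1.trans ?_) h2 (abs_nonneg _) (by positivity)
        gcongr
    _ = Real.exp ((β * A + Dt) * |x - y|) * (f (g z ω y) * |g' z ω y|) := by
        have : (β * A + Dt) * |x - y| = A * (β * |x - y|) + Dt * |x - y| := by ring
        rw [this, Real.exp_add]; ring

lemma Sys.Lop_nonneg (S : Sys a b Dt β g g') {f : ℝ → ℝ}
    (hf : ∀ x ∈ Icc a b, 0 ≤ f x) {x : ℝ} (hx : x ∈ Icc a b) : 0 ≤ Lop Q g g' f x := by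
  unfold Lop
  exact tsum_nonneg fun z => integral_nonneg fun ω =>
    mul_nonneg (hf _ (S.hmaps z ω hx)) (abs_nonneg _)

lemma Sys.Lop_ofReal (S : Sys a b Dt β g g') {f : ℝ → ℝ} (hc : ContinuousOn f (Icc a b))
    (hf : ∀ x ∈ Icc a b, 0 ≤ f x) {x : ℝ} (hx : x ∈ Icc a b) :
    ENNReal.ofReal (Lop Q g g' f x) =
      ∑' z, ∫⁻ ω, ENNReal.ofReal |g' z ω x| *
        ENNReal.ofReal (IccExtend S.hab.le (domRestrict (Icc a b) f) (g z ω x)) ∂Q := by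
  have h0 : ∀ z ω, 0 ≤ f (g z ω x) * |g' z ω x| := fun z ω =>
    mul_nonneg (hf _ (S.hmaps z ω hx)) (abs_nonneg _)
  unfold Lop
  rw [ENNReal.ofReal_tsum_of_nonneg (fun z => integral_nonneg (h0 z)) (S.F_sum Q hc hx)]
  congr 1; ext z
  rw [ofReal_integral_eq_lintegral_ofReal (S.F_int Q hc z hx) (Eventually.of_forall (h0 z))]
  congr 1; ext ω
  rw [IccExtend_of_mem _ _ (S.hmaps z ω hx), mul_comm (f _),
    ENNReal.ofReal_mul (abs_nonneg _)]
  rfl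

lemma Sys.good (S : Sys a b Dt β g g') {A : ℝ} (hA : 0 < A) :
    Good a b A (β * A + Dt) (Lop Q g g') where
  congr := S.Lop_congr Q
  sub := S.Lop_sub Q
  cone := by
    intro f m hf
    have hc := hf.cont S.hab hA
    have hB : 0 < β * A + Dt := by have := S.hβ.1; have := S.hDt; positivity
    have hcone : Cone a b (β * A + Dt) (Lop Q g g' f) (∫ x in Icc a b, Lop Q g g' f x) :=
      ⟨fun x hx => S.Lop_nonneg Q hf.1 hx, fun x hx y hy => S.Lop_exp Q hA hf hx hy, rfl⟩
    refine ⟨hcone.1, hcone.2.1, ?_⟩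
    have hc2 := hcone.cont S.hab hB
    rw [← hf.2.2]
    have hext : Continuous (IccExtend S.hab.le (domRestrict (Icc a b) f)) :=
      (continuousOn_iff_continuous_domRestrict.1 hc).Icc_extend'
    rw [integral_eq_lintegral_of_nonneg_ae
        ((ae_restrict_iff' measurableSet_Icc).2 (Eventually.of_forall hcone.1))
        (hc2.aestronglyMeasurable measurableSet_Icc),
      integral_eq_lintegral_of_nonneg_ae
        ((ae_restrict_iff' measurableSet_Icc).2 (Eventually.of_forall hf.1))
        (hc.aestronglyMeasurable measurableSet_Icc)]
    congr 1
    rw [setLIntegral_congr_fun measurableSet_Icc (fun x hx => S.Lop_ofReal Q hc hf.1 hx),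
      S.dual Q (φ := fun t => ENNReal.ofReal (IccExtend S.hab.le (domRestrict (Icc a b) f) t))
        (ENNReal.measurable_ofReal.comp hext.measurable)]
    apply setLIntegral_congr_fun measurableSet_Icc
    intro x hx
    simp only
    rw [IccExtend_of_mem _ _ hx]
    rfl

lemma Sys.Lone_eq (S : Sys a b Dt β g g') (ω : Ω) {f : ℝ → ℝ} (hf : ContinuousOn f (Icc a b))
    {x : ℝ} (hx : x ∈ Icc a b) : Lone g g' ω f x = Lop (Measure.dirac ω) g g' f x := by
  unfold Lone Lop
  congr 1; ext z
  rw [integral_dirac' (fun ω => f (g z ω x) * |g' z ω x|) _ (S.F_meas hf z hx).stronglyMeasurable]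

lemma Sys.good_one (S : Sys a b Dt β g g') {A : ℝ} (hA : 0 < A) (ω : Ω) :
    Good a b A (β * A + Dt) (Lone g g' ω) where
  congr := by
    intro f f₂ h x hx
    unfold Lone
    congr 1; ext z
    rw [h (S.hmaps z ω hx)]
  sub := by
    intro f f₂ hf hf₂ x hx
    have := S.Lop_sub (Measure.dirac ω) f f₂ hf hf₂ hx
    simp only at this ⊢
    rw [S.Lone_eq ω hf hx, S.Lone_eq ω hf₂ hx, S.Lone_eq ω (f := fun x => f x - f₂ x) (hf.sub hf₂) hx]
    exact this
  cone := by
    intro f m hf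
    have hc := hf.cont S.hab hA
    have h := (S.good (Measure.dirac ω) hA).cone f m hf
    have e : EqOn (Lone g g' ω f) (Lop (Measure.dirac ω) g g' f) (Icc a b) :=
      fun x hx => S.Lone_eq ω hc hx
    refine ⟨fun x hx => by rw [e hx]; exact h.1 x hx,
      fun x hx y hy => by rw [e hx, e hy]; exact h.2.1 x hx y hy, ?_⟩
    rw [setIntegral_congr_fun measurableSet_Icc e]
    exact h.2.2

end sys


section sys2
set_option linter.unusedSectionVars false
variable {Ω : Type*} [MeasurableSpace Ω] {Z : Type*} [Countable Z] {a b Dt β : ℝ}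
  {g g' : Z → Ω → ℝ → ℝ}
variable (Q : Measure Ω) [IsProbabilityMeasure Q]

lemma Sys.dual_meas (S : Sys a b Dt β g g') {φ : ℝ → ENNReal} (hφ : Measurable φ) :
    AEMeasurable (fun x => ∑' z, ∫⁻ ω, ENNReal.ofReal |g' z ω x| * φ (g z ω x) ∂Q)
      (volume.restrict (Icc a b)) := by
  have hm : ∀ z, Measurable (Function.uncurry fun (x : ℝ) (ω : Ω) =>
      ENNReal.ofReal |g' z ω (projIcc a b S.hab.le x)| * φ (g z ω (projIcc a b S.hab.le x))) := by
    intro z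
    obtain ⟨h1, h2⟩ := S.proj_meas z
    exact (ENNReal.measurable_ofReal.comp (continuous_abs.measurable.comp h2)).mul (hφ.comp h1)
  have hproj : ∀ x ∈ Icc a b, ((projIcc a b S.hab.le x : Icc a b) : ℝ) = x := by
    intro x hx; rw [projIcc_of_mem _ hx]
  refine ⟨fun x => ∑' z, ∫⁻ ω, ENNReal.ofReal |g' z ω (projIcc a b S.hab.le x)| *
          φ (g z ω (projIcc a b S.hab.le x)) ∂Q,
    Measurable.tsum fun z => Measurable.lintegral_prod_right' (hm z), ?_⟩
  refine (ae_restrict_iff' measurableSet_Icc).2 (Eventually.of_forall fun x hx => ?_)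
  simp only [hproj x hx]

/-- a measurable majorant which is infinite on the exceptional null set -/
lemma exists_majorant {μ : Measure ℝ} {u : ℝ → ℝ} (hu : AEStronglyMeasurable u μ) :
    ∃ (v : ℝ → ℝ) (φ : ℝ → ENNReal), Measurable v ∧ Measurable φ ∧
      (∫⁻ x, φ x ∂μ = ∫⁻ x, ‖u x‖ₑ ∂μ) ∧ (∀ x, ‖u x‖ₑ ≤ φ x) ∧ (∀ x, φ x ≠ ⊤ → u x = v x) := by
  set v := hu.mk u with hv
  have hvm : Measurable v := hu.stronglyMeasurable_mk.measurable
  have hae : u =ᵐ[μ] v := hu.ae_eq_mk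
  set N := toMeasurable μ {x | u x ≠ v x} with hN
  have hN0 : μ N = 0 := by rw [hN, measure_toMeasurable]; exact hae
  have hNm : MeasurableSet N := measurableSet_toMeasurable _ _
  have hnot : ∀ x, x ∉ N → u x = v x := by
    intro x hx
    by_contra h
    exact hx (subset_toMeasurable _ _ h)
  refine ⟨v, fun x => ‖v x‖ₑ + N.indicator (fun _ => ⊤) x, hvm,
    hvm.enorm.add (measurable_const.indicator hNm), ?_, ?_, ?_⟩
  · apply lintegral_congr_ae
    have h2 : ∀ᵐ x ∂μ, x ∉ N := measure_eq_zero_iff_ae_notMem.1 hN0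
    filter_upwards [h2] with x hx
    rw [indicator_of_notMem hx, add_zero, hnot x hx]
  · intro x
    beta_reduce
    by_cases hx : x ∈ N
    · rw [indicator_of_mem hx]; simp
    · rw [indicator_of_notMem hx, add_zero, hnot x hx]
  · intro x hx
    apply hnot
    intro h
    beta_reduce at hx
    rw [indicator_of_mem h] at hx
    simp at hx

lemma Sys.L1_contr (S : Sys a b Dt β g g') {u : ℝ → ℝ} (hu : IntegrableOn u (Icc a b)) :
    ∫⁻ x in Icc a b, ‖Lop Q g g' u x‖ₑ ≤ ∫⁻ x in Icc a b, ‖u x‖ₑ := by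
  obtain ⟨v, φ, hv, hφ, hIntEq, hle, heq⟩ := exists_majorant hu.1
  rw [← hIntEq, ← S.dual Q hφ]
  apply lintegral_mono
  intro x
  unfold Lop
  refine enorm_tsum_le_tsum_enorm.trans (ENNReal.tsum_le_tsum fun z => ?_)
  refine (enorm_integral_le_lintegral_enorm _).trans (lintegral_mono fun ω => ?_)
  rw [enorm_mul, mul_comm, Real.enorm_eq_ofReal_abs |_|, abs_abs]
  gcongr
  exact hle _

lemma Sys.L1_good (S : Sys a b Dt β g g') {u : ℝ → ℝ} (hu : IntegrableOn u (Icc a b)) :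
    ∀ᵐ x ∂(volume.restrict (Icc a b)),
      (∀ z, Integrable (fun ω => u (g z ω x) * |g' z ω x|) Q) ∧
      Summable (fun z => ∫ ω, u (g z ω x) * |g' z ω x| ∂Q) := by
  obtain ⟨v, φ, hv, hφ, hIntEq, hle, heq⟩ := exists_majorant hu.1
  have hfin : ∫⁻ x in Icc a b, ∑' z, ∫⁻ ω, ENNReal.ofReal |g' z ω x| * φ (g z ω x) ∂Q ≠ ⊤ := by
    rw [S.dual Q hφ, hIntEq]
    exact hu.2.ne
  filter_upwards [ae_lt_top' (S.dual_meas Q hφ) hfin, ae_restrict_mem measurableSet_Icc]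
    with x hx hxI
  have hz : ∀ z, ∫⁻ ω, ENNReal.ofReal |g' z ω x| * φ (g z ω x) ∂Q ≠ ⊤ := fun z =>
    ne_top_of_le_ne_top hx.ne (ENNReal.le_tsum z)
  have hen : ∀ z ω, ‖u (g z ω x) * |g' z ω x|‖ₑ ≤ ENNReal.ofReal |g' z ω x| * φ (g z ω x) := by
    intro z ω
    rw [enorm_mul, mul_comm, Real.enorm_eq_ofReal_abs |_|, abs_abs]
    gcongr
    exact hle _
  have hI : ∀ z, Integrable (fun ω => u (g z ω x) * |g' z ω x|) Q := by
    intro z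
    have hgm := (S.hmeas z x).1
    have hgm' : Measurable fun ω => |g' z ω x| := continuous_abs.measurable.comp (S.hmeas z x).2
    have hmm : Measurable fun ω => ENNReal.ofReal |g' z ω x| * φ (g z ω x) :=
      (ENNReal.measurable_ofReal.comp hgm').mul (hφ.comp hgm)
    have hae : (fun ω => v (g z ω x) * |g' z ω x|) =ᵐ[Q] fun ω => u (g z ω x) * |g' z ω x| := by
      filter_upwards [ae_lt_top hmm (hz z)] with ω hω
      rw [heq]
      intro htop
      rw [htop, ENNReal.mul_top] at hω
      · exact absurd hω (lt_irrefl _)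
      · simpa using S.g'_ne z ω hxI
    refine ⟨((hv.comp hgm).mul hgm').aestronglyMeasurable.congr hae, ?_⟩
    exact lt_of_le_of_lt (lintegral_mono (hen z)) (lt_top_iff_ne_top.2 (hz z))
  refine ⟨hI, ?_⟩
  have hs : ∑' z, ‖∫ ω, u (g z ω x) * |g' z ω x| ∂Q‖ₑ ≠ ⊤ := by
    refine ne_top_of_le_ne_top hx.ne (ENNReal.tsum_le_tsum fun z => ?_)
    exact (enorm_integral_le_lintegral_enorm _).trans (lintegral_mono (hen z))
  have := ENNReal.summable_toReal hs
  refine Summable.of_norm (this.congr fun z => ?_)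
  rw [toReal_enorm]

lemma Sys.L1_sub (S : Sys a b Dt β g g') {u v : ℝ → ℝ} (hu : IntegrableOn u (Icc a b))
    (hv : IntegrableOn v (Icc a b)) :
    ∀ᵐ x ∂(volume.restrict (Icc a b)),
      Lop Q g g' (fun x => u x - v x) x = Lop Q g g' u x - Lop Q g g' v x := by
  filter_upwards [S.L1_good Q hu, S.L1_good Q hv] with x h1 h2
  unfold Lop
  rw [← h1.2.tsum_sub h2.2]
  congr 1; ext z
  rw [← integral_sub (h1.1 z) (h2.1 z)]
  congr 1; ext ω
  ring

lemma exists_lip_approx {a b : ℝ} (hab : a < b) {w : ℝ → ℝ} (hw : IntegrableOn w (Icc a b))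
    {η : ℝ} (hη : 0 < η) : ∃ φ : ℝ → ℝ, (∃ c : NNReal, LipschitzOnWith c φ (Icc a b)) ∧
      ∫ x in Icc a b, ‖w x - φ x‖ ≤ η := by
  have hl : 0 < b - a := by linarith
  obtain ⟨k, -, hk, hkc, hki⟩ :=
    Integrable.exists_hasCompactSupport_integral_sub_le hw (half_pos hη)
  obtain ⟨p, hp⟩ := exists_polynomial_near_of_continuousOn a b k hkc.continuousOn
    (η / 2 / (b - a)) (by positivity)
  have hpi : IntegrableOn (fun x => p.eval x) (Icc a b) :=
    p.continuous.continuousOn.integrableOn_Icc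
  refine ⟨fun x => p.eval x, ?_, ?_⟩
  · obtain ⟨C, hC⟩ := isCompact_Icc.exists_bound_of_continuousOn
      (p.derivative.continuous.continuousOn (s := Icc a b))
    refine ⟨_, lipOn_of_abs (c := C) fun x hx y hy => ?_⟩
    exact Convex.norm_image_sub_le_of_norm_hasDerivWithin_le
      (fun x _ => (p.hasDerivAt x).hasDerivWithinAt) hC (convex_Icc a b) hy hx
  · have h2 : ∫ x in Icc a b, ‖k x - p.eval x‖ ≤ η / 2 := by
      have : ∫ x in Icc a b, ‖k x - p.eval x‖ ≤ ∫ _ in Icc a b, η / 2 / (b - a) := by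
        refine setIntegral_mono_on (hki.sub hpi).norm continuousOn_const.integrableOn_Icc
          measurableSet_Icc fun x hx => ?_
        rw [Real.norm_eq_abs, abs_sub_comm]
        exact (hp x hx).le
      rw [int_const hab, div_mul_cancel₀ _ hl.ne'] at this
      exact this
    calc ∫ x in Icc a b, ‖w x - p.eval x‖
        ≤ ∫ x in Icc a b, (‖w x - k x‖ + ‖k x - p.eval x‖) := by
          refine integral_mono (Integrable.sub hw hpi).norm
            ((Integrable.sub hw hki).norm.add (Integrable.sub hki hpi).norm) fun x => ?_
          exact norm_sub_le_norm_sub_add_norm_sub _ _ _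
      _ = (∫ x in Icc a b, ‖w x - k x‖) + ∫ x in Icc a b, ‖k x - p.eval x‖ :=
          integral_add (Integrable.sub hw hki).norm (Integrable.sub hki hpi).norm
      _ ≤ η := by linarith

lemma Sys.iter_cont (S : Sys a b Dt β g g') {A : ℝ} (hA : β * A + Dt + Dt ≤ A) (hA0 : 0 < A)
    {φ : ℝ → ℝ} (hφ : ∃ c : NNReal, LipschitzOnWith c φ (Icc a b)) (n : ℕ) :
    ContinuousOn ((Lop Q g g')^[n] φ) (Icc a b) := by
  have hB : 0 < β * A + Dt := by have := S.hβ.1; have := S.hDt; positivity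
  have hs0 : 0 ≤ supOn a b φ := by
    have hc : ContinuousOn φ (Icc a b) := by
      obtain ⟨c, hc⟩ := hφ; exact hc.continuousOn
    exact (abs_nonneg _).trans (le_supOn hc (left_mem_Icc.2 S.hab.le))
  have hl0 : 0 ≤ lipC a b φ := lipC_nonneg
  obtain ⟨f', g₁, m₁', m₂', hf', hg', -, -, he⟩ :=
    pair_lemma S.hab S.hDt hB hA (List.replicate n (Lop Q g g'))
      (fun L' hL' => by rw [List.eq_of_mem_replicate hL']; exact S.good Q hA0) φ _ _ _ _
      (cone_decomp S.hab hA0 hφ)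
      (cone_const S.hab hA0 (c := supOn a b φ + lipC a b φ / A) (by positivity))
      (fun x _ => by simp)
  rw [foldl_replicate_iter] at he
  exact ((hf'.cont S.hab hA0).sub (hg'.cont S.hab hA0)).congr he

/-- an invariant L¹ function of zero mean vanishes -/
lemma Sys.unique (S : Sys a b Dt β g g') {A : ℝ} (hA : β * A + Dt + Dt ≤ A) (hA0 : 0 < A)
    {w : ℝ → ℝ} (hw : IntegrableOn w (Icc a b)) (hw0 : ∫ x in Icc a b, w x = 0)
    (hinv : w =ᵐ[volume.restrict (Icc a b)] Lop Q g g' w) :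
    w =ᵐ[volume.restrict (Icc a b)] 0 := by
  have hab := S.hab
  have hl : 0 < b - a := by linarith
  have hB : 0 < β * A + Dt := by have := S.hβ.1; have := S.hDt; positivity
  obtain ⟨hρ0, hρ1⟩ := rho_bounds hab S.hDt (show Dt ≤ A by linarith [S.hDt])
  set C := 3 * (1 + A * Real.exp (A * (b - a))) * Real.exp (A * (b - a)) / (b - a) with hC
  have hC0 : 0 ≤ C := by positivity
  have key : ∀ η : ℝ, 0 < η → ∫ x in Icc a b, ‖w x‖ ≤ η * (1 + C * (b - a)) := by
    intro η hη
    obtain ⟨φ, hφ, hφη⟩ := exists_lip_approx hab hw hη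
    set u : ℕ → ℝ → ℝ := fun n => (Lop Q g g')^[n] φ with hu
    have hcont : ∀ n, ContinuousOn (u n) (Icc a b) := fun n => S.iter_cont Q hA hA0 hφ n
    have hui : ∀ n, IntegrableOn (u n) (Icc a b) := fun n => (hcont n).integrableOn_Icc
    have hstep : ∀ n, ∫⁻ x in Icc a b, ‖w x - u n x‖ₑ ≤ ∫⁻ x in Icc a b, ‖w x - φ x‖ₑ := by
      intro n
      induction n with
      | zero => exact le_rfl
      | succ n ih =>
        refine le_trans (le_of_eq ?_) ((S.L1_contr Q (u := fun x => w x - u n x)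
          (Integrable.sub hw (hui n))).trans ih)
        apply lintegral_congr_ae
        filter_upwards [S.L1_sub Q hw (hui n), hinv] with x h1 h2
        rw [h1, ← h2]
        have e2 : u (n + 1) x = Lop Q g g' (u n) x := by
          simp only [hu]; rw [Function.iterate_succ_apply']
        rw [e2]
    have hstep' : ∀ n, ∫ x in Icc a b, ‖w x - u n x‖ ≤ η := by
      intro n
      refine le_trans ?_ hφη
      have i0 := Integrable.sub hw (hui 0)
      rw [integral_norm_eq_lintegral_enorm
          (show AEStronglyMeasurable (fun x => w x - u n x) _ from (Integrable.sub hw (hui n)).1),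
        integral_norm_eq_lintegral_enorm (show AEStronglyMeasurable (fun x => w x - φ x) _ from i0.1)]
      exact ENNReal.toReal_mono (show _ ≠ ⊤ from i0.2.ne) (hstep n)
    have hmean : |∫ x in Icc a b, φ x| ≤ η := by
      have e : ∫ x in Icc a b, φ x = - ∫ x in Icc a b, (w x - φ x) := by
        have hwi : Integrable w (volume.restrict (Icc a b)) := hw
        have hφi : Integrable φ (volume.restrict (Icc a b)) := hui 0
        rw [integral_sub hwi hφi, hw0]
        simp
      rw [e, abs_neg]
      exact (norm_integral_le_integral_norm _).trans hφη
    set X := (1 + 1 / A) * (b - a) * lipNorm a b φ with hX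
    have hn : ∀ n, ∫ x in Icc a b, ‖w x‖ ≤ η +
        C * ((1 - Dt / A * Real.exp (-(2 * A * (b - a)))) ^ n * X + η) * (b - a) := by
      intro n
      have hmb := main_bound hab S.hDt hB hA (List.replicate n (Lop Q g g'))
        (fun L' hL' => by rw [List.eq_of_mem_replicate hL']; exact S.good Q hA0) φ hφ
      rw [foldl_replicate_iter, List.length_replicate] at hmb
      have hsup : ∀ x ∈ Icc a b, ‖u n x‖ ≤
          C * ((1 - Dt / A * Real.exp (-(2 * A * (b - a)))) ^ n * X + η) := by
        intro x hx
        have e1 := le_supOn (hcont n) hx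
        have e2 : supOn a b (u n) ≤ lipNorm a b (u n) := by
          unfold lipNorm; linarith [lipC_nonneg (a := a) (b := b) (f := u n)]
        refine (e1.trans e2).trans (hmb.trans ?_)
        gcongr
      have h2 : ∫ x in Icc a b, ‖u n x‖ ≤
          C * ((1 - Dt / A * Real.exp (-(2 * A * (b - a)))) ^ n * X + η) * (b - a) := by
        rw [← int_const hab]
        exact int_le_of_le hab (hcont n).norm continuousOn_const hsup
      calc ∫ x in Icc a b, ‖w x‖ ≤ ∫ x in Icc a b, (‖w x - u n x‖ + ‖u n x‖) := by
            refine integral_mono hw.norm ((Integrable.sub hw (hui n)).norm.add (hui n).norm)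
              fun x => ?_
            have := norm_add_le (w x - u n x) (u n x)
            rwa [sub_add_cancel] at this
        _ = (∫ x in Icc a b, ‖w x - u n x‖) + ∫ x in Icc a b, ‖u n x‖ :=
            integral_add (Integrable.sub hw (hui n)).norm (hui n).norm
        _ ≤ _ := add_le_add (hstep' n) h2
    have ht : Tendsto (fun n => η +
        C * ((1 - Dt / A * Real.exp (-(2 * A * (b - a)))) ^ n * X + η) * (b - a)) atTop
        (𝓝 (η + C * (0 * X + η) * (b - a))) :=
      ((((tendsto_pow_atTop_nhds_zero_of_lt_one hρ0 hρ1).mul_const X).add_const η).const_mul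
        C |>.mul_const (b - a)).const_add η
    refine (ge_of_tendsto' ht hn).trans (le_of_eq ?_)
    ring
  have hle : ∫ x in Icc a b, ‖w x‖ ≤ 0 := by
    have hp : 0 < 1 + C * (b - a) := by positivity
    apply le_of_forall_pos_le_add
    intro ε hε
    have := key (ε / (1 + C * (b - a))) (by positivity)
    rw [div_mul_cancel₀ _ hp.ne'] at this
    linarith
  have h0 : ∫ x in Icc a b, ‖w x‖ = 0 := le_antisymm hle (integral_nonneg fun x => norm_nonneg _)
  rw [integral_eq_zero_iff_of_nonneg (fun x => norm_nonneg _) hw.norm] at h0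
  filter_upwards [h0] with x hx
  simpa using hx

end sys2


/-- under (A1)–(A2) there are κ ∈ (0,1), D₁ > 0, n₁ ∈ ℕ, independent of
ε ∈ V and of the random path, such that for every n ≥ n₁, every path of length n and every
Lipschitz Φ, ‖L_ω^n Φ‖_Lip ≤ κⁿ‖Φ‖_Lip + D₁‖Φ‖_∞; the same holds for L_{P_ε}ⁿ, each
L_{P_ε} has a spectral gap on Lipschitz functions, and for each ε ∈ V the random system has
a unique stationary density h_ε, Lipschitz and strictly positive on X. -/
theorem stmt12
    {Ω : Type*} [MeasurableSpace Ω] {Z : Type*} [Countable Z]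
    (a b : ℝ) (hab : a < b)
    (V : Set ℝ) (hV : V ∈ 𝓝 (0:ℝ))
    (P : ℝ → Measure Ω) (hP : ∀ ε, IsProbabilityMeasure (P ε))
    (g g' g'' g''' : Z → Ω → ℝ → ℝ)
    (hg1 : ∀ z ω, ∀ x ∈ Icc a b, HasDerivWithinAt (g z ω) (g' z ω x) (Icc a b) x)
    (hg2 : ∀ z ω, ∀ x ∈ Icc a b, HasDerivWithinAt (g' z ω) (g'' z ω x) (Icc a b) x)
    (hg3 : ∀ z ω, ∀ x ∈ Icc a b, HasDerivWithinAt (g'' z ω) (g''' z ω x) (Icc a b) x)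
    (hgc : ∀ z ω, ContinuousOn (g''' z ω) (Icc a b))
    (hmaps : ∀ z ω, MapsTo (g z ω) (Icc a b) (Icc a b))
    (hinj : ∀ z ω, InjOn (g z ω) (Icc a b))
    (hdisj : ∀ ω : Ω, Pairwise fun z z' : Z =>
      Disjoint (interior (g z ω '' Icc a b)) (interior (g z' ω '' Icc a b)))
    (hfull : ∀ ω, volume ((Icc a b) \ ⋃ z : Z, g z ω '' Icc a b) = 0)
    (hmeas : ∀ z x, Measurable (fun ω => g z ω x) ∧ Measurable fun ω => g' z ω x)
    -- (A1)
    (Dt : ℝ) (hDt : 0 < Dt)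
    (hdist : ∀ z ω, ∀ x ∈ Icc a b, ∀ y ∈ Icc a b, |g' z ω x / g' z ω y - 1| ≤ Dt * |x - y|)
    (M : ℝ) (hM : 0 < M)
    (hA1 : ∀ ε ∈ V,
      (Summable fun z : Z => ⨆ x : Icc a b, ∫ ω, |g'' z ω x| ∂(P ε)) ∧
      (Summable fun z : Z => ⨆ x : Icc a b, ∫ ω, |g''' z ω x| ∂(P ε)) ∧
      (∑' z : Z, ⨆ x : Icc a b, ∫ ω, |g'' z ω x| ∂(P ε)) ≤ M ∧
      (∑' z : Z, ⨆ x : Icc a b, ∫ ω, |g''' z ω x| ∂(P ε)) ≤ M)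
    -- (A2)
    (β : ℝ) (hβ : β ∈ Ioo (0:ℝ) 1)
    (hA2 : ∀ z ω, ∀ x ∈ Icc a b, |g' z ω x| ≤ β) :
    ∃ κ ∈ Ioo (0:ℝ) 1, ∃ D₁ > (0:ℝ), ∃ n₁ : ℕ,
      (∀ n : ℕ, n₁ ≤ n → ∀ l : List Ω, l.length = n → ∀ Φ : ℝ → ℝ,
        (∃ c : NNReal, LipschitzOnWith c Φ (Icc a b)) →
        lipNorm a b (Lpath g g' l Φ) ≤ κ ^ n * lipNorm a b Φ + D₁ * supOn a b Φ) ∧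
      (∀ ε ∈ V, ∀ n : ℕ, n₁ ≤ n → ∀ Φ : ℝ → ℝ,
        (∃ c : NNReal, LipschitzOnWith c Φ (Icc a b)) →
        lipNorm a b ((Lop (P ε) g g')^[n] Φ) ≤ κ ^ n * lipNorm a b Φ + D₁ * supOn a b Φ) ∧
      (∃ C > (0:ℝ), ∃ θ ∈ Ioo (0:ℝ) 1, ∀ ε ∈ V, ∀ Φ : ℝ → ℝ,
        (∃ c : NNReal, LipschitzOnWith c Φ (Icc a b)) →
        (∫ x in Icc a b, Φ x) = 0 → ∀ n : ℕ, 1 ≤ n →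
          lipNorm a b ((Lop (P ε) g g')^[n] Φ) ≤ C * θ ^ n * lipNorm a b Φ) ∧
      ∃ h : ℝ → ℝ → ℝ, ∀ ε ∈ V,
        (∃ c : NNReal, LipschitzOnWith c (h ε) (Icc a b)) ∧
        (∀ x ∈ Icc a b, 0 < h ε x) ∧
        (∫ x in Icc a b, h ε x) = b - a ∧
        (∀ x ∈ Icc a b, Lop (P ε) g g' (h ε) x = h ε x) ∧
        (∀ h' : ℝ → ℝ, IntegrableOn h' (Icc a b) volume →
          (0 ≤ᵐ[volume.restrict (Icc a b)] h') →
          (∫ x in Icc a b, h' x) = b - a →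
          (h' =ᵐ[volume.restrict (Icc a b)] fun x => Lop (P ε) g g' h' x) →
          h' =ᵐ[volume.restrict (Icc a b)] h ε) := by
  have S : Sys a b Dt β g g' := ⟨hab, hg1, fun z ω x hx => (hg2 z ω x hx).continuousWithinAt,
    hmaps, hinj, hdisj, hfull, hmeas, hDt, hdist, hβ, hA2⟩
  have hβ1 : 0 < 1 - β := by linarith [hβ.2]
  have hw : 0 < b - a := by linarith
  set A : ℝ := 2 * Dt / (1 - β) with hAdef
  have hA0 : 0 < A := by positivity
  have hA : β * A + Dt + Dt ≤ A := by
    have : A * (1 - β) = 2 * Dt := by rw [hAdef]; field_simp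
    linarith
  have hB : 0 < β * A + Dt := by have := hβ.1; positivity
  obtain ⟨hρ0, hρ1⟩ := rho_bounds hab hDt (show Dt ≤ A by linarith)
  set C := 3 * (1 + A * Real.exp (A * (b - a))) * Real.exp (A * (b - a)) / (b - a) with hC
  have hC0 : 0 < C := by positivity
  set ρ := 1 - Dt / A * Real.exp (-(2 * A * (b - a))) with hρ
  set C₁ := C * ((1 + 1 / A) * (b - a)) with hC₁
  have hC₁0 : 0 < C₁ := by positivity
  set κ := (1 + ρ) / 2 with hκ
  have hκ0 : 0 < κ := by rw [hκ]; linarith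
  have hκ1 : κ < 1 := by rw [hκ]; linarith
  have hρκ : ρ < κ := by rw [hκ]; linarith
  have hbd : ∀ (Ls : List ((ℝ → ℝ) → ℝ → ℝ)), (∀ L ∈ Ls, Good a b A (β * A + Dt) L) →
      ∀ Φ : ℝ → ℝ, (∃ c : NNReal, LipschitzOnWith c Φ (Icc a b)) →
      lipNorm a b (Ls.foldl (fun Ψ L => L Ψ) Φ) ≤
        C₁ * ρ ^ Ls.length * lipNorm a b Φ + C * |∫ x in Icc a b, Φ x| := by
    intro Ls hLs Φ hΦ
    refine (main_bound hab hDt hB hA Ls hLs Φ hΦ).trans (le_of_eq ?_)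
    rw [← hC, ← hρ, hC₁]; ring
  have hnn : ∀ Φ : ℝ → ℝ, (∃ c : NNReal, LipschitzOnWith c Φ (Icc a b)) →
      0 ≤ lipNorm a b Φ ∧ |∫ x in Icc a b, Φ x| ≤ supOn a b Φ * (b - a) := by
    intro Φ hΦ
    have hc : ContinuousOn Φ (Icc a b) := by
      obtain ⟨c, hc⟩ := hΦ; exact hc.continuousOn
    have hs0 : 0 ≤ supOn a b Φ := (abs_nonneg _).trans (le_supOn hc (left_mem_Icc.2 hab.le))
    refine ⟨add_nonneg hs0 lipC_nonneg, ?_⟩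
    refine (abs_integral_le_integral_abs (f := Φ)).trans ?_
    rw [← int_const hab]
    exact int_le_of_le hab hc.norm continuousOn_const (fun x hx => le_supOn hc hx)
  obtain ⟨n₁, hn₁⟩ : ∃ n₁ : ℕ, ∀ n, n₁ ≤ n → C₁ * ρ ^ n ≤ κ ^ n := by
    have ht : Tendsto (fun n : ℕ => C₁ * (ρ / κ) ^ n) atTop (𝓝 (C₁ * 0)) :=
      (tendsto_pow_atTop_nhds_zero_of_lt_one (by positivity)
        (by rw [div_lt_one hκ0]; exact hρκ)).const_mul C₁
    rw [mul_zero] at ht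
    obtain ⟨n₁, hn₁⟩ := eventually_atTop.1 (ht.eventually (gt_mem_nhds one_pos))
    refine ⟨n₁, fun n hn => ?_⟩
    have h1 := (hn₁ n hn).le
    rw [div_pow, ← mul_div_assoc, div_le_one (by positivity)] at h1
    exact h1
  have hLY : ∀ (Ls : List ((ℝ → ℝ) → ℝ → ℝ)), (∀ L ∈ Ls, Good a b A (β * A + Dt) L) →
      n₁ ≤ Ls.length → ∀ Φ : ℝ → ℝ, (∃ c : NNReal, LipschitzOnWith c Φ (Icc a b)) →
      lipNorm a b (Ls.foldl (fun Ψ L => L Ψ) Φ) ≤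
        κ ^ Ls.length * lipNorm a b Φ + C * (b - a) * supOn a b Φ := by
    intro Ls hLs hn Φ hΦ
    obtain ⟨h0, h1⟩ := hnn Φ hΦ
    have h2 := hn₁ _ hn
    refine (hbd Ls hLs Φ hΦ).trans (add_le_add (by gcongr) ?_)
    calc C * |∫ x in Icc a b, Φ x| ≤ C * (supOn a b Φ * (b - a)) := by gcongr
      _ = _ := by ring
  have hrep : ∀ ε n, ∀ L ∈ List.replicate n (Lop (P ε) g g'), Good a b A (β * A + Dt) L := by
    intro ε n L hL
    have := hP ε
    rw [List.eq_of_mem_replicate hL]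
    exact S.good (P ε) hA0
  refine ⟨κ, ⟨hκ0, hκ1⟩, C * (b - a), by positivity, n₁, ?_, ?_, ?_, ?_⟩
  · intro n hn l hl Φ hΦ
    have := hLY (l.map fun ω => Lone g g' ω) (by
      intro L hL
      obtain ⟨ω, -, rfl⟩ := List.mem_map.1 hL
      exact S.good_one hA0 ω) (by rw [List.length_map, hl]; exact hn) Φ hΦ
    rw [List.length_map, hl, List.foldl_map] at this
    exact this
  · intro ε _ n hn Φ hΦ
    have := hLY (List.replicate n (Lop (P ε) g g')) (hrep ε n)
      (by rw [List.length_replicate]; exact hn) Φ hΦ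
    rwa [List.length_replicate, foldl_replicate_iter] at this
  · refine ⟨C₁, hC₁0, κ, ⟨hκ0, hκ1⟩, fun ε _ Φ hΦ h0 n _ => ?_⟩
    have := hbd (List.replicate n (Lop (P ε) g g')) (hrep ε n) Φ hΦ
    rw [List.length_replicate, foldl_replicate_iter, h0, abs_zero, mul_zero, add_zero] at this
    have h1 := (hnn Φ hΦ).1
    refine this.trans ?_
    gcongr
  · have hst : ∀ ε, ∃ h : ℝ → ℝ, Cone a b A h (b - a) ∧
        ∀ x ∈ Icc a b, Lop (P ε) g g' h x = h x := by
      intro ε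
      have := hP ε
      exact stationary hab hDt hB hA (S.good (P ε) hA0) (S.Lop_bound (P ε))
    choose h hc hinv using hst
    refine ⟨h, fun ε _ => ⟨(hc ε).lipOn hab hA0, ?_, (hc ε).2.2, hinv ε, ?_⟩⟩
    · intro x hx
      have h1 := (hc ε).m_le hab hA0 hx
      have h2 := (hc ε).1 x hx
      rcases h2.eq_or_lt with h3 | h3
      · rw [← h3] at h1
        simp only [mul_zero, zero_mul] at h1
        linarith
      · exact h3
    · intro h' hi _ hm hfix
      have := hP ε
      have hhi : IntegrableOn (h ε) (Icc a b) := ((hc ε).cont hab hA0).integrableOn_Icc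
      have hz := S.unique (P ε) hA hA0 (w := fun x => h' x - h ε x) (Integrable.sub hi hhi)
        (by rw [integral_sub hi hhi, hm, (hc ε).2.2, sub_self])
        (by
          filter_upwards [S.L1_sub (P ε) hi hhi, hfix, ae_restrict_mem measurableSet_Icc]
            with x e1 e2 e3
          rw [e1, ← e2, hinv ε x e3])
      filter_upwards [hz] with x hx
      simp only [Pi.zero_apply] at hx
      linarith
end

section
/- There exist ε₀ ∈ (0,1) and M > 0 such that for every ε ∈ [0, ε₀] and every f ∈ C²([0,1]), the two-step annealed transfer operator L_{P_ε} = (1−ε)² L_{G∘G} + ε(1−ε) L_{G∘R} + ε(1−ε) L_{R∘G} + ε² L_{R∘R} satisfies the Lasota–Yorke inequality sup_{[0,1]} |(L_{P_ε} f)''| ≤ (π⁴(1+17ε)/576) · sup_{[0,1]} |f''| + M (sup_{[0,1]} |f'| + sup_{[0,1]} |f|); in particular for ε₀ small enough, π⁴(1+17ε)/576 < 1 for all ε ∈ [0, ε₀]. -/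
/-- Inverse branch of the Gauss map: G_n^{-1}(x) = 1/(n+x). -/
noncomputable def Ginv (n : ℕ) (x : ℝ) : ℝ := 1 / (n + x)

/-- Inverse branch of the Rényi map: R_n^{-1}(x) = 1 − 1/(n+x). -/
noncomputable def Rinv (n : ℕ) (x : ℝ) : ℝ := 1 - 1 / (n + x)

/-- Transfer operator of the composition A∘B of two maps with inverse branches
A_n^{-1}, B_k^{-1} (n,k ≥ 1):  L_{A∘B} f(x) = Σ_{n,k ≥ 1} f(A_n^{-1}(B_k^{-1}x))·|(A_n^{-1}∘B_k^{-1})'(x)|. -/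
noncomputable def Lcomp (A B : ℕ → ℝ → ℝ) (f : ℝ → ℝ) (x : ℝ) : ℝ :=
  ∑' n : ℕ, ∑' k : ℕ,
    f (A (n + 1) (B (k + 1) x)) * |deriv (fun y => A (n + 1) (B (k + 1) y)) x|


noncomputable def qq (p : ℕ × ℕ) : ℝ := (1 / ((p.1 : ℝ) + 1) ^ 2) * (1 / ((p.2 : ℝ) + 1) ^ 2)

lemma qq_nonneg (p : ℕ × ℕ) : 0 ≤ qq p := by unfold qq; positivity

lemma qq_le_one (p : ℕ × ℕ) : qq p ≤ 1 := by
  unfold qq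
  have h : ∀ n : ℕ, 1 / ((n : ℝ) + 1) ^ 2 ≤ 1 := by
    intro n
    have : (0 : ℝ) ≤ n := n.cast_nonneg
    rw [div_le_one (by positivity)]
    nlinarith
  exact mul_le_one₀ (h _) (by positivity) (h _)

lemma hasSum_qq : HasSum qq (Real.pi ^ 4 / 36) := by
  have h1 : HasSum (fun n : ℕ => 1 / ((n : ℝ) + 1) ^ 2) (Real.pi ^ 2 / 6) := by
    have := (hasSum_nat_add_iff' 1).mpr hasSum_zeta_two
    simpa using this
  have h2 := h1.mul h1
    (h1.summable.mul_of_nonneg h1.summable (fun n => by positivity) (fun n => by positivity))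
  have e : Real.pi ^ 4 / 36 = Real.pi ^ 2 / 6 * (Real.pi ^ 2 / 6) := by ring
  rw [e]
  exact h2

lemma endpoint_bound (g g' : ℝ → ℝ) (C : ℝ) (hg : ∀ x ∈ Set.Ioo (0:ℝ) 1, HasDerivAt g (g' x) x)
    (hC : ∀ x ∈ Set.Ioo (0:ℝ) 1, |g' x| ≤ C) (x : ℝ) (hx : x ∈ Set.Icc (0:ℝ) 1) :
    |deriv g x| ≤ C := by
  have hC0 : 0 ≤ C := (abs_nonneg _).trans (hC (1/2) (by norm_num))
  by_cases hxI : x ∈ Set.Ioo (0:ℝ) 1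
  · rw [(hg x hxI).deriv]; exact hC x hxI
  by_cases hd : DifferentiableAt ℝ g x
  swap
  · rw [deriv_zero_of_not_differentiableAt hd]; simpa using hC0
  have hcl : x ∈ closure (Set.Ioo (0:ℝ) 1) := by
    rw [closure_Ioo (by norm_num)]; exact hx
  haveI : (nhdsWithin x (Set.Ioo (0:ℝ) 1)).NeBot := mem_closure_iff_nhdsWithin_neBot.mp hcl
  have hlip : ∀ y ∈ Set.Ioo (0:ℝ) 1, ∀ z ∈ Set.Ioo (0:ℝ) 1, ‖g y - g z‖ ≤ C * ‖y - z‖ := by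
    intro y hy z hz
    exact Convex.norm_image_sub_le_of_norm_hasDerivWithin_le
      (fun u hu => (hg u hu).hasDerivWithinAt) (fun u hu => hC u hu) (convex_Ioo 0 1) hz hy
  have hlip2 : ∀ y ∈ Set.Ioo (0:ℝ) 1, ‖g y - g x‖ ≤ C * ‖y - x‖ := by
    intro y hy
    have hc : Filter.Tendsto g (nhdsWithin x (Set.Ioo (0:ℝ) 1)) (nhds (g x)) :=
      hd.continuousAt.tendsto.mono_left nhdsWithin_le_nhds
    have hi : Filter.Tendsto (fun z : ℝ => z) (nhdsWithin x (Set.Ioo (0:ℝ) 1)) (nhds x) :=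
      nhdsWithin_le_nhds
    refine le_of_tendsto_of_tendsto (tendsto_const_nhds.sub hc).norm
      ((tendsto_const_nhds.sub hi).norm.const_mul C) ?_
    filter_upwards [self_mem_nhdsWithin] with z hz using hlip y hy z hz
  have hs := (hasDerivAt_iff_tendsto_slope.mp hd.hasDerivAt).mono_left
    (nhdsWithin_mono x (s := Set.Ioo (0:ℝ) 1) (fun y hy h => hxI (by
      rw [Set.mem_singleton_iff] at h; rwa [h] at hy)))
  refine le_of_tendsto hs.abs ?_
  filter_upwards [self_mem_nhdsWithin] with y hy
  have hne : y - x ≠ 0 := fun h => hxI (by rw [sub_eq_zero] at h; rwa [h] at hy)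
  rw [slope_def_field, abs_div, div_le_iff₀ (abs_pos.mpr hne)]
  exact hlip2 y hy

lemma generic_bound (A B : ℕ → ℝ → ℝ) (σ : ℝ) (hσ : |σ| = 1) (a b : ℕ × ℕ → ℝ) (c : ℝ)
    (hmem : ∀ p : ℕ × ℕ, ∀ x ∈ Set.Ioo (0:ℝ) 1, A (p.1 + 1) (B (p.2 + 1) x) ∈ Set.Ioo (0:ℝ) 1)
    (hder : ∀ p : ℕ × ℕ, ∀ x ∈ Set.Ioo (0:ℝ) 1,
      HasDerivAt (fun y => A (p.1 + 1) (B (p.2 + 1) y)) (σ * ((a p * x + b p)⁻¹) ^ 2) x)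
    (hpos : ∀ p : ℕ × ℕ, ∀ x ∈ Set.Ioo (0:ℝ) 1, 0 < a p * x + b p)
    (ha : ∀ p : ℕ × ℕ, ∀ x ∈ Set.Ioo (0:ℝ) 1, |a p * (a p * x + b p)⁻¹| ≤ 2)
    (hq : ∀ p : ℕ × ℕ, ∀ x ∈ Set.Ioo (0:ℝ) 1, ((a p * x + b p)⁻¹) ^ 2 ≤ qq p)
    (hc : ∀ p : ℕ × ℕ, ∀ x ∈ Set.Ioo (0:ℝ) 1, ((a p * x + b p)⁻¹) ^ 6 ≤ c * qq p)
    (f f1 f2 : ℝ → ℝ) (N0 N1 N2 : ℝ)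
    (hf1 : ∀ x ∈ Set.Ioo (0:ℝ) 1, HasDerivAt f (f1 x) x)
    (hf2 : ∀ x ∈ Set.Ioo (0:ℝ) 1, HasDerivAt f1 (f2 x) x)
    (h0 : ∀ x ∈ Set.Ioo (0:ℝ) 1, |f x| ≤ N0)
    (h1 : ∀ x ∈ Set.Ioo (0:ℝ) 1, |f1 x| ≤ N1)
    (h2 : ∀ x ∈ Set.Ioo (0:ℝ) 1, |f2 x| ≤ N2) :
    ∃ F1 F2 : ℝ → ℝ, (∀ x ∈ Set.Ioo (0:ℝ) 1, HasDerivAt (Lcomp A B f) (F1 x) x) ∧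
      (∀ x ∈ Set.Ioo (0:ℝ) 1, HasDerivAt F1 (F2 x) x) ∧
      (∀ x ∈ Set.Ioo (0:ℝ) 1, |F2 x| ≤ (c * N2 + 24 * (N1 + N0)) * (Real.pi ^ 4 / 36)) := by
  have hhalf : (1/2 : ℝ) ∈ Set.Ioo (0:ℝ) 1 := by norm_num
  have hN0 : 0 ≤ N0 := (abs_nonneg _).trans (h0 _ hhalf)
  have hN1 : 0 ≤ N1 := (abs_nonneg _).trans (h1 _ hhalf)
  have hN2 : 0 ≤ N2 := (abs_nonneg _).trans (h2 _ hhalf)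
  have hσ2 : σ * σ = 1 := by
    have := abs_mul_abs_self σ
    rw [hσ] at this; linarith
  set φ : ℕ × ℕ → ℝ → ℝ := fun p y => A (p.1 + 1) (B (p.2 + 1) y) with hφ
  set i : ℕ × ℕ → ℝ → ℝ := fun p y => (a p * y + b p)⁻¹ with hi
  have hi0 : ∀ p : ℕ × ℕ, ∀ x ∈ Set.Ioo (0:ℝ) 1, 0 ≤ i p x := fun p x hx =>
    inv_nonneg.mpr (hpos p x hx).le
  have hid : ∀ p : ℕ × ℕ, ∀ x ∈ Set.Ioo (0:ℝ) 1,
      HasDerivAt (i p) (-(a p) * (i p x) ^ 2) x := by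
    intro p x hx
    have h : HasDerivAt (fun y => a p * y + b p) (a p) x := by
      simpa using ((hasDerivAt_id x).const_mul (a p)).add_const (b p)
    have := h.inv (hpos p x hx).ne'
    convert! this using 1
    simp only [hi]
    field_simp
  set t0 : ℕ × ℕ → ℝ → ℝ := fun p y => f (φ p y) * (i p y) ^ 2 with ht0
  set t1 : ℕ × ℕ → ℝ → ℝ := fun p y =>
    σ * f1 (φ p y) * (i p y) ^ 4 - 2 * a p * f (φ p y) * (i p y) ^ 3 with ht1
  set t2 : ℕ × ℕ → ℝ → ℝ := fun p y =>
    f2 (φ p y) * (i p y) ^ 6 - 6 * a p * σ * f1 (φ p y) * (i p y) ^ 5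
      + 6 * (a p) ^ 2 * f (φ p y) * (i p y) ^ 4 with ht2
  have hd0 : ∀ p : ℕ × ℕ, ∀ x ∈ Set.Ioo (0:ℝ) 1, HasDerivAt (t0 p) (t1 p x) x := by
    intro p x hx
    have e1 := (hf1 _ (hmem p x hx)).comp x (hder p x hx)
    have e2 := e1.mul ((hid p x hx).pow 2)
    convert! e2 using 1
    simp only [ht1, hφ, hi, Function.comp, Pi.pow_apply]
    push_cast
    ring
  have hd1 : ∀ p : ℕ × ℕ, ∀ x ∈ Set.Ioo (0:ℝ) 1, HasDerivAt (t1 p) (t2 p x) x := by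
    intro p x hx
    have e1 := (hf1 _ (hmem p x hx)).comp x (hder p x hx)
    have e2 := (hf2 _ (hmem p x hx)).comp x (hder p x hx)
    have e3 := ((e2.const_mul σ).mul ((hid p x hx).pow 4)).sub
      ((e1.const_mul (2 * a p)).mul ((hid p x hx).pow 3))
    convert! e3 using 1
    simp only [ht2, hφ, hi, Function.comp, Pi.pow_apply]
    push_cast
    linear_combination (-(f2 (A (p.1 + 1) (B (p.2 + 1) x))) * ((a p * x + b p)⁻¹) ^ 6) * hσ2
  have hb0 : ∀ p : ℕ × ℕ, ∀ x ∈ Set.Ioo (0:ℝ) 1, ‖t0 p x‖ ≤ N0 * qq p := by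
    intro p x hx
    rw [Real.norm_eq_abs, ht0]
    simp only
    rw [abs_mul, abs_of_nonneg (sq_nonneg (i p x))]
    exact mul_le_mul (h0 _ (hmem p x hx)) (hq p x hx) (sq_nonneg _) hN0
  have hqsq : ∀ p : ℕ × ℕ, ∀ x ∈ Set.Ioo (0:ℝ) 1, (i p x) ^ 4 ≤ qq p := by
    intro p x hx
    have e1 := hq p x hx
    have e2 := qq_le_one p
    have : (i p x) ^ 4 = (i p x) ^ 2 * (i p x) ^ 2 := by ring
    rw [this]
    nlinarith [sq_nonneg (i p x), qq_nonneg p, show (i p x)^2 ≤ qq p from e1]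
  have hb1 : ∀ p : ℕ × ℕ, ∀ x ∈ Set.Ioo (0:ℝ) 1, ‖t1 p x‖ ≤ (N1 + 4 * N0) * qq p := by
    intro p x hx
    have hm := hmem p x hx
    have E1 : |σ * f1 (φ p x) * (i p x) ^ 4| ≤ N1 * qq p := by
      rw [abs_mul, abs_mul, hσ, one_mul, abs_of_nonneg (pow_nonneg (hi0 p x hx) 4)]
      exact mul_le_mul (h1 _ hm) (hqsq p x hx) (pow_nonneg (hi0 p x hx) 4) hN1
    have E2 : |2 * a p * f (φ p x) * (i p x) ^ 3| ≤ 4 * N0 * qq p := by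
      have : 2 * a p * f (φ p x) * (i p x) ^ 3 = (2 * (a p * i p x)) * (f (φ p x) * (i p x) ^ 2) := by
        ring
      rw [this, abs_mul, abs_mul, abs_two, mul_assoc (4:ℝ)]
      exact mul_le_mul (by linarith [ha p x hx]) (hb0 p x hx) (abs_nonneg _) (by norm_num)
    rw [Real.norm_eq_abs]
    refine (abs_sub _ _).trans ?_
    linarith
  have hb2 : ∀ p : ℕ × ℕ, ∀ x ∈ Set.Ioo (0:ℝ) 1,
      ‖t2 p x‖ ≤ (c * N2 + 24 * (N1 + N0)) * qq p := by
    intro p x hx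
    have hm := hmem p x hx
    have hE1 : |f1 (φ p x) * (i p x) ^ 4| ≤ N1 * qq p := by
      rw [abs_mul, abs_of_nonneg (pow_nonneg (hi0 p x hx) 4)]
      exact mul_le_mul (h1 _ hm) (hqsq p x hx) (pow_nonneg (hi0 p x hx) 4) hN1
    have E1 : |f2 (φ p x) * (i p x) ^ 6| ≤ N2 * (c * qq p) := by
      rw [abs_mul, abs_of_nonneg (pow_nonneg (hi0 p x hx) 6)]
      exact mul_le_mul (h2 _ hm) (hc p x hx) (pow_nonneg (hi0 p x hx) 6) hN2
    have E2 : |6 * a p * σ * f1 (φ p x) * (i p x) ^ 5| ≤ 12 * (N1 * qq p) := by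
      have : 6 * a p * σ * f1 (φ p x) * (i p x) ^ 5
          = (6 * σ * (a p * i p x)) * (f1 (φ p x) * (i p x) ^ 4) := by
        ring
      rw [this, abs_mul, abs_mul, abs_mul, hσ]
      refine mul_le_mul ?_ hE1 (abs_nonneg _) (by norm_num)
      rw [abs_of_pos (by norm_num : (0:ℝ) < 6)]
      linarith [ha p x hx]
    have E3 : |6 * (a p) ^ 2 * f (φ p x) * (i p x) ^ 4| ≤ 24 * (N0 * qq p) := by
      have : 6 * (a p) ^ 2 * f (φ p x) * (i p x) ^ 4
          = (6 * (a p * i p x) ^ 2) * (f (φ p x) * (i p x) ^ 2) := by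
        ring
      rw [this, abs_mul]
      refine mul_le_mul ?_ (hb0 p x hx) (abs_nonneg _) (by norm_num)
      rw [abs_of_nonneg (by positivity), ← sq_abs]
      nlinarith [show |a p * i p x| ≤ 2 from ha p x hx, abs_nonneg (a p * i p x)]
    rw [Real.norm_eq_abs]
    refine (abs_add_le _ _).trans ?_
    have := abs_sub (f2 (φ p x) * (i p x) ^ 6) (6 * a p * σ * f1 (φ p x) * (i p x) ^ 5)
    have hp := mul_nonneg hN1 (qq_nonneg p)
    linarith
  have hs0 : ∀ x ∈ Set.Ioo (0:ℝ) 1, Summable (fun p => t0 p x) := fun x hx =>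
    Summable.of_norm_bounded (hasSum_qq.summable.mul_left N0) (fun p => hb0 p x hx)
  have hs1 : ∀ x ∈ Set.Ioo (0:ℝ) 1, Summable (fun p => t1 p x) := fun x hx =>
    Summable.of_norm_bounded (hasSum_qq.summable.mul_left (N1 + 4 * N0)) (fun p => hb1 p x hx)
  have hL : ∀ x ∈ Set.Ioo (0:ℝ) 1, Lcomp A B f x = ∑' p, t0 p x := by
    intro x hx
    rw [(hs0 x hx).tsum_prod]
    unfold Lcomp
    congr 1; ext n; congr 1; ext k
    have := (hder (n, k) x hx).deriv
    simp only at this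
    rw [this, abs_mul, hσ, one_mul, abs_of_nonneg (sq_nonneg _)]
  refine ⟨fun x => ∑' p, t1 p x, fun x => ∑' p, t2 p x, ?_, ?_, ?_⟩
  · intro x hx
    have := hasDerivAt_tsum_of_isPreconnected (hasSum_qq.summable.mul_left (N1 + 4 * N0)) isOpen_Ioo
      isPreconnected_Ioo hd0 hb1 hhalf (hs0 _ hhalf) hx
    refine this.congr_of_eventuallyEq ?_
    filter_upwards [isOpen_Ioo.mem_nhds hx] with y hy using hL y hy
  · intro x hx
    exact hasDerivAt_tsum_of_isPreconnected (hasSum_qq.summable.mul_left _) isOpen_Ioo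
      isPreconnected_Ioo hd1 hb2 hhalf (hs1 _ hhalf) hx
  · intro x hx
    exact tsum_of_norm_bounded (hasSum_qq.mul_left _) (fun p => hb2 p x hx)

/-- Elementary facts for the inner branch `1/(m + z)`. -/
lemma inv_sq_le (p : ℕ × ℕ) (D : ℝ) (h : ((p.1:ℝ) + 1) * (p.2 + 1) ≤ D) :
    (D⁻¹) ^ 2 ≤ qq p := by
  have e : qq p = ((((p.1:ℝ) + 1) * (p.2 + 1))⁻¹) ^ 2 := by
    unfold qq; field_simp
  rw [e]
  have : 0 < ((p.1:ℝ) + 1) * (p.2 + 1) := by positivity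
  have hD0 : 0 ≤ D⁻¹ := inv_nonneg.mpr (this.le.trans h)
  gcongr

lemma inv_six_le (p : ℕ × ℕ) (D : ℝ) (h : ((p.1:ℝ) + 1) * (p.2 + 1) ≤ D) :
    (D⁻¹) ^ 6 ≤ 1 * qq p := by
  have h1 := inv_sq_le p D h
  have h2 := qq_le_one p
  have h3 : (D⁻¹) ^ 2 ≤ 1 := h1.trans h2
  have h4 : 0 ≤ (D⁻¹) ^ 2 := sq_nonneg _
  calc (D⁻¹) ^ 6 = (D⁻¹) ^ 2 * ((D⁻¹) ^ 2 * (D⁻¹) ^ 2) := by ring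
    _ ≤ (D⁻¹) ^ 2 * 1 := by
        apply mul_le_mul_of_nonneg_left _ h4
        nlinarith
    _ ≤ 1 * qq p := by linarith

lemma inv_six_le' (p : ℕ × ℕ) (D : ℝ) (h : ((p.1:ℝ) + 1) * (p.2 + 1) + 1 ≤ D) :
    (D⁻¹) ^ 6 ≤ (1 / 64) * qq p := by
  have e : qq p = ((((p.1:ℝ) + 1) * (p.2 + 1))⁻¹) ^ 2 := by
    unfold qq; field_simp
  rw [e]
  set u := ((p.1:ℝ) + 1) * (p.2 + 1) with hu
  have hu1 : 1 ≤ u := by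
    have h1 : (0:ℝ) ≤ p.1 := Nat.cast_nonneg _
    have h2 : (0:ℝ) ≤ p.2 := Nat.cast_nonneg _
    rw [hu]; nlinarith [mul_nonneg h1 h2]
  have hD : 0 < D := by linarith
  have h4 : 4 * u ≤ D ^ 2 := by nlinarith [sq_nonneg (u - 1)]
  have h6 : 64 * u ^ 2 ≤ D ^ 6 := by
    calc 64 * u ^ 2 ≤ 64 * u ^ 3 := by nlinarith [sq_nonneg u]
      _ = (4 * u) ^ 3 := by ring
      _ ≤ (D ^ 2) ^ 3 := by gcongr
      _ = D ^ 6 := by ring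
  calc (D⁻¹) ^ 6 = (D ^ 6)⁻¹ := by rw [inv_pow]
    _ ≤ (64 * u ^ 2)⁻¹ := by gcongr
    _ = (1 / 64) * (u⁻¹) ^ 2 := by field_simp

/-- Data for the outer Gauss/Rényi branch composed with the inner Gauss branch. -/
lemma G_facts (p : ℕ × ℕ) (x : ℝ) (hx : x ∈ Set.Ioo (0:ℝ) 1) :
    Ginv (p.1 + 1) (Ginv (p.2 + 1) x) ∈ Set.Ioo (0:ℝ) 1 ∧
    HasDerivAt (fun y => Ginv (p.1 + 1) (Ginv (p.2 + 1) y))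
      (1 * ((((p.1:ℝ) + 1) * x + (((p.1:ℝ) + 1) * (p.2 + 1) + 1))⁻¹) ^ 2) x ∧
    ((p.1:ℝ) + 1) * (p.2 + 1) + 1 ≤ ((p.1:ℝ) + 1) * x + (((p.1:ℝ) + 1) * (p.2 + 1) + 1) ∧
    ((p.1:ℝ) + 1) ≤ 2 * (((p.1:ℝ) + 1) * x + (((p.1:ℝ) + 1) * (p.2 + 1) + 1)) := by
  obtain ⟨hx0, hx1⟩ := hx
  have hn : (0:ℝ) ≤ p.1 := Nat.cast_nonneg _
  have hk : (0:ℝ) ≤ p.2 := Nat.cast_nonneg _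
  have hnk := mul_nonneg hn hk
  have hnx := mul_nonneg hn hx0.le
  have hkx : 0 < (p.2:ℝ) + 1 + x := by linarith
  have hI : 0 < 1 / ((p.2:ℝ) + 1 + x) := by positivity
  have hE : 0 < (p.1:ℝ) + 1 + 1 / ((p.2:ℝ) + 1 + x) := by linarith
  refine ⟨?_, ?_, by nlinarith, by nlinarith⟩
  · unfold Ginv
    push_cast
    refine ⟨by positivity, ?_⟩
    rw [div_lt_one hE]; linarith
  · unfold Ginv
    push_cast
    have d1 : HasDerivAt (fun y : ℝ => (p.2:ℝ) + 1 + y) 1 x := (hasDerivAt_id x).const_add _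
    have d2 := (d1.inv hkx.ne').const_add ((p.1:ℝ) + 1)
    have hE' : (p.1:ℝ) + 1 + ((p.2:ℝ) + 1 + x)⁻¹ ≠ 0 := by
      rw [← one_div]; exact hE.ne'
    have d3 := d2.inv hE'
    have hD : ((p.1:ℝ) + 1) * x + (((p.1:ℝ) + 1) * (p.2 + 1) + 1) ≠ 0 := by nlinarith
    have hEq : (p.1:ℝ) + 1 + ((p.2:ℝ) + 1 + x)⁻¹
        = (((p.1:ℝ) + 1) * x + (((p.1:ℝ) + 1) * (p.2 + 1) + 1)) / ((p.2:ℝ) + 1 + x) := by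
      field_simp; ring
    simp only [one_div]
    convert! d3 using 1
    simp only [Pi.inv_apply]
    rw [hEq]
    field_simp

/-- Data for the outer Gauss branch composed with the inner Rényi branch. -/
lemma R_facts (p : ℕ × ℕ) (x : ℝ) (hx : x ∈ Set.Ioo (0:ℝ) 1) :
    Ginv (p.1 + 1) (Rinv (p.2 + 1) x) ∈ Set.Ioo (0:ℝ) 1 ∧
    HasDerivAt (fun y => Ginv (p.1 + 1) (Rinv (p.2 + 1) y))
      (-1 * ((((p.1:ℝ) + 2) * x + (((p.1:ℝ) + 2) * (p.2 + 1) - 1))⁻¹) ^ 2) x ∧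
    ((p.1:ℝ) + 1) * (p.2 + 1) ≤ ((p.1:ℝ) + 2) * x + (((p.1:ℝ) + 2) * (p.2 + 1) - 1) ∧
    ((p.1:ℝ) + 2) ≤ 2 * (((p.1:ℝ) + 2) * x + (((p.1:ℝ) + 2) * (p.2 + 1) - 1)) := by
  obtain ⟨hx0, hx1⟩ := hx
  have hn : (0:ℝ) ≤ p.1 := Nat.cast_nonneg _
  have hk : (0:ℝ) ≤ p.2 := Nat.cast_nonneg _
  have hnk := mul_nonneg hn hk
  have hnx := mul_nonneg hn hx0.le
  have hkx : 0 < (p.2:ℝ) + 1 + x := by linarith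
  have hI : 1 / ((p.2:ℝ) + 1 + x) < 1 := by
    rw [div_lt_one hkx]; linarith
  have hE : 0 < (p.1:ℝ) + 1 + (1 - 1 / ((p.2:ℝ) + 1 + x)) := by linarith
  refine ⟨?_, ?_, by nlinarith, by nlinarith⟩
  · unfold Ginv Rinv
    push_cast
    refine ⟨by positivity, ?_⟩
    rw [div_lt_one hE]; linarith
  · unfold Ginv Rinv
    push_cast
    have d1 : HasDerivAt (fun y : ℝ => (p.2:ℝ) + 1 + y) 1 x := (hasDerivAt_id x).const_add _
    have d2 := ((d1.inv hkx.ne').const_sub 1).const_add ((p.1:ℝ) + 1)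
    have hE' : (p.1:ℝ) + 1 + (1 - ((p.2:ℝ) + 1 + x)⁻¹) ≠ 0 := by
      rw [← one_div]; exact hE.ne'
    have d3 := d2.inv hE'
    have hD : ((p.1:ℝ) + 2) * x + (((p.1:ℝ) + 2) * (p.2 + 1) - 1) ≠ 0 := by nlinarith
    have hEq : (p.1:ℝ) + 1 + (1 - ((p.2:ℝ) + 1 + x)⁻¹)
        = (((p.1:ℝ) + 2) * x + (((p.1:ℝ) + 2) * (p.2 + 1) - 1)) / ((p.2:ℝ) + 1 + x) := by
      field_simp; ring
    simp only [one_div]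
    convert! d3 using 1
    simp only [Pi.inv_apply]
    rw [hEq]
    field_simp

lemma Rinv_eq (n : ℕ) (y : ℝ) : Rinv n y = 1 - Ginv n y := rfl

lemma one_sub_mem {y : ℝ} (h : y ∈ Set.Ioo (0:ℝ) 1) : 1 - y ∈ Set.Ioo (0:ℝ) 1 :=
  ⟨by linarith [h.2], by linarith [h.1]⟩

lemma abs_ratio {a D : ℝ} (ha : 0 ≤ a) (hD : 0 < D) (h : a ≤ 2 * D) : |a * D⁻¹| ≤ 2 := by
  rw [abs_of_nonneg (by positivity), ← div_eq_mul_inv, div_le_iff₀ hD]; exact h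

lemma final_coef (ε P N2 S : ℝ) (h0 : 0 ≤ ε) (h1 : ε ≤ 1 / 50) (hP : 0 ≤ P) (hN : 0 ≤ N2) :
    (1 - ε) ^ 2 * ((1 / 64 * N2 + 24 * S) * (P / 36)) + ε * (1 - ε) * ((1 * N2 + 24 * S) * (P / 36))
      + ε * (1 - ε) * ((1 * N2 + 24 * S) * (P / 36)) + ε ^ 2 * ((1 * N2 + 24 * S) * (P / 36))
      ≤ P * (1 + 17 * ε) / 576 * N2 + (24 * P / 36) * S := by
  have hPN := mul_nonneg hP hN
  have key : (1 - ε) ^ 2 / 64 + 2 * ε * (1 - ε) + ε ^ 2 ≤ (1 + 17 * ε) / 16 := by nlinarith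
  have := mul_le_mul_of_nonneg_left key hPN
  nlinarith

/-- a uniform Lasota–Yorke inequality for the second derivative of the
two-step annealed Gauss–Rényi transfer operator
L_{P_ε} = (1−ε)² L_{G∘G} + ε(1−ε) L_{G∘R} + ε(1−ε) L_{R∘G} + ε² L_{R∘R}:
there are ε₀ ∈ (0,1) and M > 0 such that for all ε ∈ [0,ε₀] and f ∈ C²([0,1]),
sup|(L_{P_ε}f)''| ≤ (π⁴(1+17ε)/576)·sup|f''| + M(sup|f'| + sup|f|), with
π⁴(1+17ε)/576 < 1. -/
theorem stmt15 :
    ∃ ε₀ ∈ Set.Ioo (0:ℝ) 1, ∃ M > (0:ℝ), ∀ ε ∈ Set.Icc (0:ℝ) ε₀,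
      Real.pi ^ 4 * (1 + 17 * ε) / 576 < 1 ∧
      ∀ f : ℝ → ℝ, ContDiffOn ℝ 2 f (Set.Icc 0 1) →
        (⨆ x : Set.Icc (0:ℝ) 1, |iteratedDeriv 2 (fun y =>
              (1 - ε) ^ 2 * Lcomp Ginv Ginv f y + ε * (1 - ε) * Lcomp Ginv Rinv f y
              + ε * (1 - ε) * Lcomp Rinv Ginv f y + ε ^ 2 * Lcomp Rinv Rinv f y) x|)
          ≤ Real.pi ^ 4 * (1 + 17 * ε) / 576 *
              (⨆ x : Set.Icc (0:ℝ) 1, |iteratedDerivWithin 2 f (Set.Icc 0 1) x|)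
            + M * ((⨆ x : Set.Icc (0:ℝ) 1, |derivWithin f (Set.Icc 0 1) x|)
                + ⨆ x : Set.Icc (0:ℝ) 1, |f x|) := by
  have hpi : Real.pi ^ 4 < 100 := by
    have h1 := Real.pi_lt_d2
    have h2 := Real.pi_pos
    have h3 : Real.pi ^ 2 < 9.93 := by nlinarith
    have h4 : 0 < Real.pi ^ 2 := by positivity
    have : Real.pi ^ 4 = Real.pi ^ 2 * Real.pi ^ 2 := by ring
    rw [this]; nlinarith
  have hpi0 : 0 < Real.pi ^ 4 := by positivity
  refine ⟨1 / 50, by norm_num, 24 * Real.pi ^ 4 / 36, by positivity, ?_⟩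
  rintro ε ⟨hε0, hε1⟩
  refine ⟨by nlinarith, ?_⟩
  intro f hf
  have hU : UniqueDiffOn ℝ (Set.Icc (0:ℝ) 1) := uniqueDiffOn_Icc (by norm_num)
  have sup : ∀ g : ℝ → ℝ, ContinuousOn g (Set.Icc 0 1) →
      ∀ x ∈ Set.Ioo (0:ℝ) 1, |g x| ≤ ⨆ x : Set.Icc (0:ℝ) 1, |g x| := by
    intro g hg x hx
    have hb : BddAbove (Set.range (fun x : Set.Icc (0:ℝ) 1 => |g x|)) := by
      have := (isCompact_Icc.bddAbove_image hg.abs)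
      rwa [Set.image_eq_range] at this
    exact le_ciSup hb ⟨x, Set.Ioo_subset_Icc_self hx⟩
  have h0 := sup f hf.continuousOn
  have h1 := sup (derivWithin f (Set.Icc 0 1)) (hf.continuousOn_derivWithin hU (by norm_num))
  have h2 := sup (iteratedDerivWithin 2 f (Set.Icc 0 1))
    (hf.continuousOn_iteratedDerivWithin le_rfl hU)
  set N0 := ⨆ x : Set.Icc (0:ℝ) 1, |f x|
  set N1 := ⨆ x : Set.Icc (0:ℝ) 1, |derivWithin f (Set.Icc 0 1) x|
  set N2 := ⨆ x : Set.Icc (0:ℝ) 1, |iteratedDerivWithin 2 f (Set.Icc 0 1) x|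
  have hf1 : ∀ x ∈ Set.Ioo (0:ℝ) 1, HasDerivAt f (derivWithin f (Set.Icc 0 1) x) x := by
    intro x hx
    exact ((hf.differentiableOn (by norm_num)) x
      (Set.Ioo_subset_Icc_self hx)).hasDerivWithinAt.hasDerivAt (Icc_mem_nhds hx.1 hx.2)
  have hf2 : ∀ x ∈ Set.Ioo (0:ℝ) 1, HasDerivAt (derivWithin f (Set.Icc 0 1))
      (iteratedDerivWithin 2 f (Set.Icc 0 1) x) x := by
    intro x hx
    have hd := hf.differentiableOn_iteratedDerivWithin (m := 1) (by norm_num) hU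
    rw [iteratedDerivWithin_succ, ← iteratedDerivWithin_one]
    exact (hd x (Set.Ioo_subset_Icc_self hx)).hasDerivWithinAt.hasDerivAt
      (Icc_mem_nhds hx.1 hx.2)
  have hnn : ∀ n : ℕ, (0:ℝ) ≤ n := fun n => Nat.cast_nonneg n
  have gD : ∀ p : ℕ × ℕ, ∀ x ∈ Set.Ioo (0:ℝ) 1,
      0 < ((p.1:ℝ) + 1) * x + (((p.1:ℝ) + 1) * (p.2 + 1) + 1) := by
    intro p x hx
    have := (G_facts p x hx).2.2.1
    have : 0 ≤ ((p.1:ℝ) + 1) * (p.2 + 1) := by positivity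
    linarith
  have rD : ∀ p : ℕ × ℕ, ∀ x ∈ Set.Ioo (0:ℝ) 1,
      0 < ((p.1:ℝ) + 2) * x + (((p.1:ℝ) + 2) * (p.2 + 1) - 1) := by
    intro p x hx
    have := (R_facts p x hx).2.2.1
    have : 0 < ((p.1:ℝ) + 1) * (p.2 + 1) := by positivity
    linarith
  obtain ⟨a1, a2, ha1, ha2, ha3⟩ := generic_bound Ginv Ginv 1 (by norm_num)
    (fun p => (p.1:ℝ) + 1) (fun p => ((p.1:ℝ) + 1) * (p.2 + 1) + 1) (1 / 64)
    (fun p x hx => (G_facts p x hx).1) (fun p x hx => (G_facts p x hx).2.1) gD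
    (fun p x hx => abs_ratio (by positivity) (gD p x hx) (G_facts p x hx).2.2.2)
    (fun p x hx => inv_sq_le p _ (by linarith [(G_facts p x hx).2.2.1]))
    (fun p x hx => inv_six_le' p _ (G_facts p x hx).2.2.1)
    f _ _ N0 N1 N2 hf1 hf2 h0 h1 h2
  obtain ⟨b1, b2, hb1, hb2, hb3⟩ := generic_bound Ginv Rinv (-1) (by norm_num)
    (fun p => (p.1:ℝ) + 2) (fun p => ((p.1:ℝ) + 2) * (p.2 + 1) - 1) 1
    (fun p x hx => (R_facts p x hx).1) (fun p x hx => (R_facts p x hx).2.1) rD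
    (fun p x hx => abs_ratio (by positivity) (rD p x hx) (R_facts p x hx).2.2.2)
    (fun p x hx => inv_sq_le p _ (R_facts p x hx).2.2.1)
    (fun p x hx => inv_six_le p _ (R_facts p x hx).2.2.1)
    f _ _ N0 N1 N2 hf1 hf2 h0 h1 h2
  obtain ⟨c1, c2, hc1, hc2, hc3⟩ := generic_bound Rinv Ginv (-1) (by norm_num)
    (fun p => (p.1:ℝ) + 1) (fun p => ((p.1:ℝ) + 1) * (p.2 + 1) + 1) 1
    (fun p x hx => one_sub_mem (G_facts p x hx).1)
    (fun p x hx => by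
      have := (G_facts p x hx).2.1.const_sub 1
      rw [← neg_mul] at this
      exact this) gD
    (fun p x hx => abs_ratio (by positivity) (gD p x hx) (G_facts p x hx).2.2.2)
    (fun p x hx => inv_sq_le p _ (by linarith [(G_facts p x hx).2.2.1]))
    (fun p x hx => inv_six_le p _ (by linarith [(G_facts p x hx).2.2.1]))
    f _ _ N0 N1 N2 hf1 hf2 h0 h1 h2
  obtain ⟨d1, d2, hd1, hd2, hd3⟩ := generic_bound Rinv Rinv 1 (by norm_num)
    (fun p => (p.1:ℝ) + 2) (fun p => ((p.1:ℝ) + 2) * (p.2 + 1) - 1) 1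
    (fun p x hx => one_sub_mem (R_facts p x hx).1)
    (fun p x hx => by
      have := (R_facts p x hx).2.1.const_sub 1
      rw [← neg_mul, neg_neg] at this
      exact this) rD
    (fun p x hx => abs_ratio (by positivity) (rD p x hx) (R_facts p x hx).2.2.2)
    (fun p x hx => inv_sq_le p _ (R_facts p x hx).2.2.1)
    (fun p x hx => inv_six_le p _ (R_facts p x hx).2.2.1)
    f _ _ N0 N1 N2 hf1 hf2 h0 h1 h2
  have hhalf : (1/2 : ℝ) ∈ Set.Ioo (0:ℝ) 1 := by norm_num
  have hN2 : 0 ≤ N2 := (abs_nonneg _).trans (h2 _ hhalf)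
  have w1 : 0 ≤ (1 - ε) ^ 2 := sq_nonneg _
  have w2 : 0 ≤ ε * (1 - ε) := mul_nonneg hε0 (by linarith)
  have w3 : 0 ≤ ε ^ 2 := sq_nonneg _
  haveI : Nonempty (Set.Icc (0:ℝ) 1) := ⟨⟨0, by norm_num⟩⟩
  refine ciSup_le ?_
  rintro ⟨x, hx⟩
  rw [iteratedDeriv_succ, iteratedDeriv_one]
  refine endpoint_bound _ (fun x => (1 - ε) ^ 2 * a2 x + ε * (1 - ε) * b2 x
              + ε * (1 - ε) * c2 x + ε ^ 2 * d2 x) _ ?_ ?_ x hx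
  · intro y hy
    have e2 := ((((ha2 y hy).const_mul ((1 - ε) ^ 2)).add
      ((hb2 y hy).const_mul (ε * (1 - ε)))).add ((hc2 y hy).const_mul (ε * (1 - ε)))).add
      ((hd2 y hy).const_mul (ε ^ 2))
    refine e2.congr_of_eventuallyEq ?_
    filter_upwards [isOpen_Ioo.mem_nhds hy] with z hz
    have e1 := ((((ha1 z hz).const_mul ((1 - ε) ^ 2)).add
      ((hb1 z hz).const_mul (ε * (1 - ε)))).add ((hc1 z hz).const_mul (ε * (1 - ε)))).add
      ((hd1 z hz).const_mul (ε ^ 2))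
    exact e1.deriv
  · intro y hy
    refine le_trans ?_ (final_coef ε (Real.pi ^ 4) N2 (N1 + N0) hε0 hε1 hpi0.le hN2)
    refine (abs_add_le _ _).trans (add_le_add ((abs_add_le _ _).trans
      (add_le_add ((abs_add_le _ _).trans (add_le_add ?_ ?_)) ?_)) ?_)
    · rw [abs_mul, abs_of_nonneg w1]; exact mul_le_mul_of_nonneg_left (ha3 y hy) w1
    · rw [abs_mul, abs_of_nonneg w2]; exact mul_le_mul_of_nonneg_left (hb3 y hy) w2
    · rw [abs_mul, abs_of_nonneg w2]; exact mul_le_mul_of_nonneg_left (hc3 y hy) w2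
    · rw [abs_mul, abs_of_nonneg w3]; exact mul_le_mul_of_nonneg_left (hd3 y hy) w3
end
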